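/- arXiv:1612.04206 — 2 statements merged into one kernel-verified Lean document; each statement's English description precedes it below -/
import Mathlib

section
/- Let n ≥ 3 and let λ, μ, ν be integers with 0 < λ ≤ μ ≤ ν ≤ λ + μ and ν ≥ 3, and set P = P_n(λ,μ,ν). Over an algebraically closed field of characteristic 0, let X ⊂ P be the hypersurface defined by a x² + b y² + c z² + f x y = 0, where a, b, c, f are general homogeneous polynomials in u_0,…,u_{n−1} of degrees −λ+μ+ν, λ−μ+ν, λ+μ−ν, ν respectively. Then X is smooth. -/
/-!
Formalization framework for "Stable rationality of higher dimensional conic bundles"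
(Ahmadinezhad–Okada).

We model a weighted-projective-space bundle `P` over `ℙ^{n-1}` (in particular the
`ℙ²`-bundle `P_n(k,l,m) = ℙ(𝒪(-k) ⊕ 𝒪(-l) ⊕ 𝒪(-m))`, and the `ℙ(1,1,2)`-bundle `R`)
through its Cox ring `K[u_0,…,u_{n-1}, x_0,…,x_{m-1}]`, bigraded by
`deg u_i = (1,0)`, `deg x_j = (w j, a j)`, together with the action of the
two-dimensional torus on the affine cone.  A member `X` of the complete linear
system `|𝒪_P(α,β)| = |α F + β D|` (`F` the pullback of the hyperplane class of
`ℙ^{n-1}`, `D` the tautological class) is recorded by a bihomogeneous polynomial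
`g` of bidegree `(α,β)`, and the projection `π : X → ℙ^{n-1}` is induced by the
coordinates `u_0,…,u_{n-1}`.

Geometric notions are rendered as follows (all are genuine definitions):

* a *general* (resp. *very general*) member of a linear system: the property holds
  on a nonempty principal Zariski-open subset of the parameter space (resp. away
  from countably many proper closed subsets);
* smoothness of `X`: the Jacobian criterion on the punctured affine cone (where the
  torus acts freely the quotient map is a torsor, so this is smoothness of `X`);
* the function field `K(X)`: the degree-`(0,0)` part of the fraction field of the
  homogeneous coordinate ring `Cox/(g)`, i.e. the subalgebra generated by ratios of
  bihomogeneous elements of equal bidegree;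
* rationality: `K(X)` is `K`-isomorphic to a purely transcendental extension of
  `K` (i.e. `X` is birational to a projective space);
* stable rationality: `K(X)(x_1,…,x_r) ≅_K K(y_1,…,y_s)` for some `r,s`
  (i.e. `X × ℙ^r` is birational to a projective space);
* normality: the local rings of the relevant locus of the affine cone are
  integrally closed (the punctured cone is a smooth torsor over `X`);
* terminal singularities: rendered as `X` normal with singular locus of
  codimension at least 3, which is the form terminality takes for the general
  members appearing in the paper;
* ℚ-factoriality together with `ρ(X) = 2` (i.e. the divisor class group of `X` is
  spanned up to torsion by the fibre class `F` and the tautological class `D`):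
  rendered by requiring every relevant bihomogeneous height-one prime `P` of the
  coordinate ring of `X` to contain a bihomogeneous element lying in no other such
  prime (so that `div(f) = k·P` and `[P] ∈ ℚ⟨F, D⟩`);
* ampleness of `𝒪_X(α,β)`: some multiple is very ample, rendered by requiring the
  bihomogeneous sections of that multiple to be base point free, to separate
  points, and to separate tangent vectors (modulo the torus directions) on the
  cone over `X`;
* `π`-ampleness of `-K_X`: by adjunction `-K_X = 𝒪_X(e,1)` with
  `e = n + Σ w - deg g`, and relative ampleness over the projective base means
  some twist `𝒪_X(e+N,1)` by pullback classes from `ℙ^{n-1}` is ample;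
* connectedness of the fibres of `π : X → ℙ^{n-1}`: no fibre admits a disjoint
  covering by two zero sets of families of weighted-homogeneous polynomials, each
  meeting the fibre (i.e. Zariski-connectedness of the fibres), and all fibres are
  nonempty;
* a conic bundle (Mori fibre space of relative dimension one, Definition 2.5 of
  the paper): `X` is irreducible (the ideal of `g` is prime), normal, has only
  terminal singularities, `π` has connected fibres, `-K_X` is `π`-ample, and
  `ρ(X) = 2`; all in the above renderings.
-/

open MvPolynomial

set_option maxHeartbeats 1600000
set_option synthInstance.maxHeartbeats 400000

namespace ConicBundleFormalization

noncomputable section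

variable (K : Type) [Field K]

/-! ### The Cox ring and bihomogeneity -/

/-- The Cox ring of an `(m-1)`-dimensional weighted-projective-space bundle over
`ℙ^{n-1}`: variables `u_i` (`i : Fin n`) of bidegree `(1,0)` and fibre variables
`x_j` (`j : Fin m`) of bidegree `(w j, a j)`. -/
abbrev Cox (n m : ℕ) : Type := MvPolynomial (Fin n ⊕ Fin m) K

/-- `p` is bihomogeneous of bidegree `(α, β)` for the grading `deg u_i = (1,0)`,
`deg x_j = (w j, a j)`. -/
def IsBihom (n m : ℕ) (w : Fin m → ℤ) (a : Fin m → ℕ) (α : ℤ) (β : ℕ)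
    (p : Cox K n m) : Prop :=
  ∀ e ∈ p.support,
    ((∑ i : Fin n, (e (Sum.inl i) : ℤ)) + ∑ j : Fin m, (e (Sum.inr j) : ℤ) * w j = α) ∧
    ((∑ j : Fin m, e (Sum.inr j) * a j) = β)

/-- A polynomial in `u_0, …, u_{n-1}` is homogeneous of degree `d ∈ ℤ`
(for `d < 0` this forces `p = 0`). -/
def IsHomogZ (n : ℕ) (d : ℤ) (p : MvPolynomial (Fin n) K) : Prop :=
  ∀ e ∈ p.support, (∑ i : Fin n, (e i : ℤ)) = d

/-- A polynomial in the fibre variables is weighted-homogeneous of degree `e` for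
the weights `a`. -/
def IsWHom (m : ℕ) (a : Fin m → ℕ) (e : ℕ) (q : MvPolynomial (Fin m) K) : Prop :=
  ∀ ex ∈ q.support, (∑ j : Fin m, ex j * a j) = e

/-! ### Genericity: general and very general members of a linear system -/

/-- Evaluation of a polynomial `D` in the coefficients of `p`; such `D` are the
polynomial functions on the parameter space of the linear system. -/
def evalCoeff {n m : ℕ} (p : Cox K n m)
    (D : MvPolynomial ((Fin n ⊕ Fin m) →₀ ℕ) K) : K :=
  MvPolynomial.eval (fun e => p.coeff e) D

/-- `Pred` holds for a *general* member of the complete linear system of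
bihomogeneous polynomials of bidegree `(α,β)`: it holds on a nonempty principal
Zariski-open subset of the parameter space. -/
def GenerallyHolds (n m : ℕ) (w : Fin m → ℤ) (a : Fin m → ℕ) (α : ℤ) (β : ℕ)
    (Pred : Cox K n m → Prop) : Prop :=
  ∃ D : MvPolynomial ((Fin n ⊕ Fin m) →₀ ℕ) K,
    (∃ p₀, IsBihom K n m w a α β p₀ ∧ evalCoeff K p₀ D ≠ 0) ∧
    ∀ p, IsBihom K n m w a α β p → evalCoeff K p D ≠ 0 → Pred p

/-- `Pred` holds for a *very general* member of the complete linear system of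
bihomogeneous polynomials of bidegree `(α,β)`: it holds away from countably many
proper Zariski-closed subsets of the parameter space. -/
def VeryGenerallyHolds (n m : ℕ) (w : Fin m → ℤ) (a : Fin m → ℕ) (α : ℤ) (β : ℕ)
    (Pred : Cox K n m → Prop) : Prop :=
  ∃ D : ℕ → MvPolynomial ((Fin n ⊕ Fin m) →₀ ℕ) K,
    (∀ i, ∃ p₀, IsBihom K n m w a α β p₀ ∧ evalCoeff K p₀ (D i) ≠ 0) ∧
    ∀ p, IsBihom K n m w a α β p → (∀ i, evalCoeff K p (D i) ≠ 0) → Pred p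

/-- Evaluation of a polynomial `D` in the coefficients of a quadruple
`(a,b,c,f)` of polynomials in `u_0,…,u_{n-1}`. -/
def evalCoeff4 {n : ℕ} (abcf : Fin 4 → MvPolynomial (Fin n) K)
    (D : MvPolynomial (Fin 4 × (Fin n →₀ ℕ)) K) : K :=
  MvPolynomial.eval (fun q => (abcf q.1).coeff q.2) D

/-- `Pred` holds for a *general* quadruple `(a,b,c,f)` of homogeneous polynomials
in `u_0,…,u_{n-1}` of respective degrees `degs 0, …, degs 3`. -/
def GenerallyHolds4 (n : ℕ) (degs : Fin 4 → ℤ)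
    (Pred : (Fin 4 → MvPolynomial (Fin n) K) → Prop) : Prop :=
  ∃ D : MvPolynomial (Fin 4 × (Fin n →₀ ℕ)) K,
    (∃ abcf : Fin 4 → MvPolynomial (Fin n) K,
      (∀ i, IsHomogZ K n (degs i) (abcf i)) ∧ evalCoeff4 K abcf D ≠ 0) ∧
    ∀ abcf : Fin 4 → MvPolynomial (Fin n) K,
      (∀ i, IsHomogZ K n (degs i) (abcf i)) → evalCoeff4 K abcf D ≠ 0 → Pred abcf

/-! ### Points of the bundle: the punctured affine cone and the torus action -/

/-- A point of the affine cone `𝔸^n × 𝔸^m` over the bundle. -/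
abbrev Pt (n m : ℕ) : Type := (Fin n → K) × (Fin m → K)

/-- Evaluation of a Cox ring element at a point of the affine cone. -/
def evalPt {n m : ℕ} (p : Pt K n m) (f : Cox K n m) : K :=
  MvPolynomial.eval (Sum.elim p.1 p.2) f

/-- Membership in the complement of the irrelevant locus
`V(u_0,…,u_{n-1}) ∪ V(x_0,…,x_{m-1})`. -/
def InCone {n m : ℕ} (p : Pt K n m) : Prop := p.1 ≠ 0 ∧ p.2 ≠ 0

/-- Equivalence of two cone points under the action of the torus `𝔾_m²`:
`(s,t)·(u,x) = (s·u_i, s^{w j} t^{a j}·x_j)`.  The points of the bundle are the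
equivalence classes of points of the punctured cone. -/
def ToricEq {n m : ℕ} (w : Fin m → ℤ) (a : Fin m → ℕ) (p q : Pt K n m) : Prop :=
  ∃ s t : Kˣ, (∀ i, q.1 i = (s : K) * p.1 i) ∧
    (∀ j, q.2 j = ((s ^ (w j) : Kˣ) : K) * (t : K) ^ (a j) * p.2 j)

/-- The punctured affine cone over the member `X = {g = 0}`. -/
def XCone {n m : ℕ} (g : Cox K n m) : Set (Pt K n m) :=
  {p | InCone K p ∧ evalPt K p g = 0}

/-! ### Smoothness via the Jacobian criterion on the cone -/

/-- The hypersurface `{g = 0}` is smooth along (the image of) `S ⊆ 𝔸^n × 𝔸^m`: at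
every point of `S` lying on the cone over `X` some partial derivative of `g` is
nonzero.  On loci where the torus acts freely this is the Jacobian criterion for
smoothness of `X` itself. -/
def JacobiSmoothOn {n m : ℕ} (g : Cox K n m) (S : Set (Pt K n m)) : Prop :=
  ∀ p ∈ S, evalPt K p g = 0 → ∃ v : Fin n ⊕ Fin m, evalPt K p (pderiv v g) ≠ 0

/-- The member `X = {g = 0}` of the linear system is smooth (nonsingular). -/
def IsSmoothModel {n m : ℕ} (g : Cox K n m) : Prop :=
  JacobiSmoothOn K g {p | InCone K p}

/-! ### The function field, rationality, and stable rationality -/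

/-- The homogeneous coordinate ring `Cox/(g)` of the member `X = {g = 0}`,
i.e. the coordinate ring of the affine cone over `X`. -/
abbrev coneRing {n m : ℕ} (g : Cox K n m) : Type :=
  Cox K n m ⧸ Ideal.span {g}

/-- The total fraction ring of the affine cone over `X`; the function field of the
cone when `g` is prime. -/
def FracCone {n m : ℕ} (g : Cox K n m) : Type := FractionRing (coneRing K g)

instance {n m : ℕ} (g : Cox K n m) : CommRing (FracCone K g) :=
  inferInstanceAs (CommRing (FractionRing (coneRing K g)))

instance {n m : ℕ} (g : Cox K n m) : Algebra K (FracCone K g) :=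
  inferInstanceAs (Algebra K (FractionRing (coneRing K g)))

instance {n m : ℕ} (g : Cox K n m) : Algebra (coneRing K g) (FracCone K g) :=
  inferInstanceAs (Algebra (coneRing K g) (FractionRing (coneRing K g)))

/-- The canonical map from the Cox ring to the fraction ring of the cone over `X`. -/
def toFrac {n m : ℕ} (g : Cox K n m) : Cox K n m →+* FracCone K g :=
  (algebraMap (coneRing K g) (FracCone K g)).comp
    (Ideal.Quotient.mk (Ideal.span {g}))

/-- The set of degree-`(0,0)` fractions on the cone over `X`: ratios `p/q` of
bihomogeneous elements of equal bidegree (phrased multiplicatively, avoiding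
inverses). -/
def ratioSet {n m : ℕ} (w : Fin m → ℤ) (a : Fin m → ℕ) (g : Cox K n m) :
    Set (FracCone K g) :=
  {φ | ∃ (α : ℤ) (β : ℕ) (p q : Cox K n m),
    IsBihom K n m w a α β p ∧ IsBihom K n m w a α β q ∧
    toFrac K g q ≠ 0 ∧ φ * toFrac K g q = toFrac K g p}

/-- The `K`-algebra of rational functions on `X = {g = 0}`: the fractions of
degree `(0,0)`.  When `g` is prime this is the function field `K(X)`. -/
def functionFieldModel {n m : ℕ} (w : Fin m → ℤ) (a : Fin m → ℕ) (g : Cox K n m) :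
    Subalgebra K (FracCone K g) :=
  Algebra.adjoin K (ratioSet K w a g)

/-- `X = {g = 0}` is rational: its function field is `K`-isomorphic to a purely
transcendental extension `K(y_1,…,y_N)` of `K`, i.e. `X` is birational to a
projective space. -/
def IsRationalModel {n m : ℕ} (w : Fin m → ℤ) (a : Fin m → ℕ) (g : Cox K n m) :
    Prop :=
  ∃ N : ℕ, Nonempty
    (functionFieldModel K w a g ≃ₐ[K] FractionRing (MvPolynomial (Fin N) K))

/-- `X = {g = 0}` is stably rational: `X × ℙ^r` is birational to a projective
space for some `r`, i.e. `K(X)(x_1,…,x_r) ≅_K K(y_1,…,y_s)` for some `r, s`. -/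
def IsStablyRationalModel {n m : ℕ} (w : Fin m → ℤ) (a : Fin m → ℕ)
    (g : Cox K n m) : Prop :=
  ∃ r s : ℕ, Nonempty
    ((FractionRing (MvPolynomial (Fin r) (functionFieldModel K w a g)))
      ≃ₐ[K] FractionRing (MvPolynomial (Fin s) K))

/-! ### Normality, terminal singularities, class group, ampleness, fibres -/

/-- A prime of the Cox ring is *relevant* if it does not contain either component
of the irrelevant ideal `(u_0,…,u_{n-1}) ∩ (x_0,…,x_{m-1})`. -/
def RelevantPrime {n m : ℕ} (P : Ideal (Cox K n m)) : Prop :=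
  (∃ i, X (Sum.inl i) ∉ P) ∧ (∃ j, X (Sum.inr j) ∉ P)

/-- `X = {g = 0}` is normal: the local rings of the relevant locus of its affine
cone are integrally closed (the punctured cone is a smooth torsor over `X`, so
this is normality of `X`). -/
def IsNormalModel {n m : ℕ} (g : Cox K n m) : Prop :=
  ∀ P : PrimeSpectrum (coneRing K g),
    ((∃ i, Ideal.Quotient.mk (Ideal.span {g}) (X (Sum.inl i)) ∉ P.asIdeal) ∧
     (∃ j, Ideal.Quotient.mk (Ideal.span {g}) (X (Sum.inr j)) ∉ P.asIdeal)) →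
    IsIntegrallyClosed (Localization.AtPrime P.asIdeal)

/-- The singular locus of `X = {g = 0}` has codimension at least `c`: every
relevant prime of the Cox ring containing `g` and all its partial derivatives has
height at least `c + 1` (the height in the cone exceeds the codimension in `X`
by one). -/
def SingularLocusCodimAtLeast {n m : ℕ} (g : Cox K n m) (c : ℕ) : Prop :=
  ∀ P : PrimeSpectrum (Cox K n m), RelevantPrime K P.asIdeal →
    g ∈ P.asIdeal → (∀ v : Fin n ⊕ Fin m, pderiv v g ∈ P.asIdeal) →
    ((c + 1 : ℕ) : WithBot (WithTop ℕ)) ≤ ringKrullDim (Localization.AtPrime P.asIdeal)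

/-- Rendering of "`X` has only terminal singularities" for the members considered
in the paper: `X` is normal and its singular locus has codimension at least 3
(cf. the proof of Lemma 2.8, where the general members with `2m > d > l+m` have
ordinary double points along a nonsingular center of codimension 3). -/
def HasOnlyTerminalSingularitiesModel {n m : ℕ} (g : Cox K n m) : Prop :=
  IsNormalModel K g ∧ SingularLocusCodimAtLeast K g 3

/-- An ideal of the Cox ring is bihomogeneous if it is generated by its
bihomogeneous elements. -/
def IsBihomIdeal {n m : ℕ} (w : Fin m → ℤ) (a : Fin m → ℕ)
    (P : Ideal (Cox K n m)) : Prop :=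
  P ≤ Ideal.span {f | f ∈ P ∧ ∃ α β, IsBihom K n m w a α β f}

/-- A prime divisor of `X = {g = 0}`: a relevant bihomogeneous prime of the Cox
ring containing `g` of height 2 (height 1 over `(g)`). -/
def IsPrimeDivisorOn {n m : ℕ} (w : Fin m → ℤ) (a : Fin m → ℕ) (g : Cox K n m)
    (P : PrimeSpectrum (Cox K n m)) : Prop :=
  g ∈ P.asIdeal ∧ RelevantPrime K P.asIdeal ∧ IsBihomIdeal K w a P.asIdeal ∧
    ringKrullDim (Localization.AtPrime P.asIdeal) = (2 : WithBot (WithTop ℕ))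

/-- Rendering of "`X` is ℚ-factorial with `ρ(X) = 2`", i.e. the divisor class
group of `X` is spanned up to torsion by the pullback `F` of the hyperplane class
and the tautological class `D`: every prime divisor `P` of `X` carries a
bihomogeneous form `f` vanishing on `P` and on no other prime divisor, so that
`div(f) = k·P` for some `k ≥ 1` and hence `[P] ∈ ℚ⟨F,D⟩` in `Cl(X) ⊗ ℚ`. -/
def ClassGroupSpannedByFD {n m : ℕ} (w : Fin m → ℤ) (a : Fin m → ℕ)
    (g : Cox K n m) : Prop :=
  ∀ P : PrimeSpectrum (Cox K n m), IsPrimeDivisorOn K w a g P →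
    ∃ (α : ℤ) (β : ℕ) (f : Cox K n m),
      f ∉ Ideal.span {g} ∧ IsBihom K n m w a α β f ∧ f ∈ P.asIdeal ∧
      ∀ Q : PrimeSpectrum (Cox K n m), IsPrimeDivisorOn K w a g Q → Q ≠ P →
        f ∉ Q.asIdeal

/-- Rendering of "`ρ(X) ≥ 3`": the divisor class group of `X` is not spanned up to
torsion by the fibre class `F` and the tautological class `D`. -/
def PicardRankAtLeastThree {n m : ℕ} (w : Fin m → ℤ) (a : Fin m → ℕ)
    (g : Cox K n m) : Prop :=
  ¬ ClassGroupSpannedByFD K w a g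

/-- The cone over the fibre of `π : X → ℙ^{n-1}` over the point `[u] ∈ ℙ^{n-1}`. -/
def fibreCone {n m : ℕ} (g : Cox K n m) (u : Fin n → K) : Set (Fin m → K) :=
  {v | v ≠ 0 ∧ evalPt K (u, v) g = 0}

/-- The fibres of `π : X → ℙ^{n-1}` are nonempty and connected: no fibre can be
covered by two disjoint nonempty closed subsets, closed subsets of the fibre
being cut out by weighted-homogeneous polynomials in the fibre variables. -/
def FibresNonemptyAndConnected {n m : ℕ} (a : Fin m → ℕ) (g : Cox K n m) : Prop :=
  ∀ u : Fin n → K, u ≠ 0 →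
    (fibreCone K g u).Nonempty ∧
    ∀ A B : Set (MvPolynomial (Fin m) K),
      (∀ q ∈ A ∪ B, ∃ e, IsWHom K m a e q) →
      (∀ v ∈ fibreCone K g u,
        (∀ q ∈ A, MvPolynomial.eval v q = 0) ∨ (∀ q ∈ B, MvPolynomial.eval v q = 0)) →
      (∀ v ∈ fibreCone K g u,
        ¬ ((∀ q ∈ A, MvPolynomial.eval v q = 0) ∧ (∀ q ∈ B, MvPolynomial.eval v q = 0))) →
      ¬ ((∃ v ∈ fibreCone K g u, ∀ q ∈ A, MvPolynomial.eval v q = 0) ∧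
         (∃ v ∈ fibreCone K g u, ∀ q ∈ B, MvPolynomial.eval v q = 0))

/-- The infinitesimal generator of the first torus factor at a cone point. -/
def orbitVec₁ {n m : ℕ} (w : Fin m → ℤ) (p : Pt K n m) : (Fin n ⊕ Fin m) → K :=
  Sum.elim (fun i => p.1 i) (fun j => (w j : K) * p.2 j)

/-- The infinitesimal generator of the second torus factor at a cone point. -/
def orbitVec₂ {n m : ℕ} (a : Fin m → ℕ) (p : Pt K n m) : (Fin n ⊕ Fin m) → K :=
  Sum.elim (fun _ => 0) (fun j => (a j : K) * p.2 j)

/-- The bihomogeneous forms of bidegree `(α,β)` have no base point on `X`. -/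
def BasePointFreeOnX {n m : ℕ} (w : Fin m → ℤ) (a : Fin m → ℕ) (g : Cox K n m)
    (α : ℤ) (β : ℕ) : Prop :=
  ∀ p ∈ XCone K g, ∃ s, IsBihom K n m w a α β s ∧ evalPt K p s ≠ 0

/-- The bihomogeneous forms of bidegree `(α,β)` separate the points of `X`. -/
def SeparatesPointsOnX {n m : ℕ} (w : Fin m → ℤ) (a : Fin m → ℕ) (g : Cox K n m)
    (α : ℤ) (β : ℕ) : Prop :=
  ∀ p ∈ XCone K g, ∀ q ∈ XCone K g, ¬ ToricEq K w a p q →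
    ∃ s₁ s₂, IsBihom K n m w a α β s₁ ∧ IsBihom K n m w a α β s₂ ∧
      evalPt K p s₁ * evalPt K q s₂ ≠ evalPt K q s₁ * evalPt K p s₂

/-- The bihomogeneous forms of bidegree `(α,β)` separate the tangent vectors of
`X`: for every cone point `p` of `X` and every tangent vector `t` of the cone over
`X` at `p` not tangent to the torus orbit, some form vanishing at `p` has nonzero
derivative along `t`. -/
def SeparatesTangentsOnX {n m : ℕ} (w : Fin m → ℤ) (a : Fin m → ℕ) (g : Cox K n m)
    (α : ℤ) (β : ℕ) : Prop :=
  ∀ p ∈ XCone K g, ∀ t : (Fin n ⊕ Fin m) → K,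
    (∑ v : Fin n ⊕ Fin m, t v * evalPt K p (pderiv v g)) = 0 →
    t ∉ Submodule.span K {orbitVec₁ K w p, orbitVec₂ K a p} →
    ∃ s, IsBihom K n m w a α β s ∧ evalPt K p s = 0 ∧
      (∑ v : Fin n ⊕ Fin m, t v * evalPt K p (pderiv v s)) ≠ 0

/-- The class `𝒪_X(α,β)` is ample on `X = {g = 0}`: some positive multiple is very
ample, i.e. its forms are base point free on `X` and separate points and tangent
vectors. -/
def IsAmpleClassOnX {n m : ℕ} (w : Fin m → ℤ) (a : Fin m → ℕ) (g : Cox K n m)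
    (α : ℤ) (β : ℕ) : Prop :=
  ∃ t : ℕ, 0 < t ∧
    BasePointFreeOnX K w a g (t * α) (t * β) ∧
    SeparatesPointsOnX K w a g (t * α) (t * β) ∧
    SeparatesTangentsOnX K w a g (t * α) (t * β)

/-- The canonical class of the ambient bundle `P`, by the toric formula
`K_P = -Σ deg(variables)`. -/
def ambientCanonicalClass (n m : ℕ) (w : Fin m → ℤ) : ℤ × ℤ :=
  (-(n : ℤ) - ∑ j : Fin m, w j, -(m : ℤ))

/-- The anticanonical class `-K_X = -(K_P + X)|_X` of a member `X ∈ |𝒪_P(α,β)|`,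
by adjunction. -/
def memberAntiCanonicalClass (n m : ℕ) (w : Fin m → ℤ) (α : ℤ) (β : ℕ) : ℤ × ℤ :=
  (-((ambientCanonicalClass n m w).1 + α), -((ambientCanonicalClass n m w).2 + β))

/-- `-K_X` is `π`-ample for the projection `π : X → ℙ^{n-1}`: some twist of `-K_X`
by the pullback of a (sufficiently ample) divisor on the base is ample. -/
def AntiCanonicalIsRelativelyAmple {n m : ℕ} (w : Fin m → ℤ) (a : Fin m → ℕ)
    (g : Cox K n m) (α : ℤ) (β : ℕ) : Prop :=
  ∃ N : ℤ,
    IsAmpleClassOnX K w a g ((memberAntiCanonicalClass n m w α β).1 + N)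
      (memberAntiCanonicalClass n m w α β).2.toNat

/-- Rendering of Definition 2.5 of the paper: the projection
`π : X → ℙ^{n-1}` of the member `X = {g = 0} ∈ |𝒪_P(d,2)|` of the `ℙ²`-bundle
`P = P_n(w 0, w 1, w 2)` over `ℙ^{n-1}` is a *conic bundle*, i.e. a Mori fibre
space of relative dimension one: `X` is an (irreducible, normal, projective)
variety with only terminal singularities, `π` has connected fibres, `-K_X` is
`π`-ample, and `X` is ℚ-factorial of Picard rank `ρ(X) = 2`.  (Being embedded in
`|𝒪_P(d,2)|` of a projectivized split rank-3 bundle, this is an *embedded* conic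
bundle in the sense of Definition 2.6.) -/
structure IsConicBundleModel (n : ℕ) (w : Fin 3 → ℤ) (d : ℤ) (g : Cox K n 3) :
    Prop where
  bihom : IsBihom K n 3 w (fun _ => 1) d 2 g
  integral : (Ideal.span {g} : Ideal (Cox K n 3)).IsPrime
  normal : IsNormalModel K g
  terminal : HasOnlyTerminalSingularitiesModel K g
  connectedFibres : FibresNonemptyAndConnected K (fun _ => 1) g
  antiCanonicalRelAmple :
    AntiCanonicalIsRelativelyAmple K w (fun _ => 1) g d 2
  picardRankTwo : ClassGroupSpannedByFD K w (fun _ => 1) g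

/-! ### The discriminant of a conic bundle -/

/-- The coefficient of the monomial `x^e` (in the fibre variables) of `g`, as a
polynomial on the base. -/
def fibreCoeff {n m : ℕ} (g : Cox K n m) (e : Fin m →₀ ℕ) :
    MvPolynomial (Fin n) K :=
  ((MvPolynomial.sumAlgEquiv K (Fin m) (Fin n))
    (MvPolynomial.rename Sum.swap g)).coeff e

/-- The symmetric matrix of the fibrewise quadratic form of a member
`X = {g = 0} ∈ |𝒪_P(d,2)|` (over a field of characteristic zero). -/
def quadraticMatrix {n : ℕ} (g : Cox K n 3) :
    Matrix (Fin 3) (Fin 3) (MvPolynomial (Fin n) K) :=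
  fun i j =>
    if i = j then fibreCoeff K g (Finsupp.single i 2)
    else MvPolynomial.C ((2 : K)⁻¹) *
      fibreCoeff K g (Finsupp.single i 1 + Finsupp.single j 1)

/-- The equation of the discriminant divisor `Δ ⊂ ℙ^{n-1}` of the conic bundle
`π : X → ℙ^{n-1}`, `X = {g = 0}`: the determinant of the associated symmetric
matrix. -/
def discriminantPoly {n : ℕ} (g : Cox K n 3) : MvPolynomial (Fin n) K :=
  (quadraticMatrix K g).det

/-- The complete linear system `|k·K_{ℙ^{n-1}} + Δ|` is nonempty, where `Δ` is the
discriminant divisor of the conic bundle `X = {g = 0}`: the divisor class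
`𝒪(deg Δ - k·n)` on `ℙ^{n-1}` contains an effective divisor. -/
def KMultipleplusDiscriminantEffective {n : ℕ} (g : Cox K n 3) (k : ℕ) : Prop :=
  discriminantPoly K g ≠ 0 ∧
    ∃ h : MvPolynomial (Fin n) K, h ≠ 0 ∧
      IsHomogZ K n (((discriminantPoly K g).totalDegree : ℤ) - k * n) h

/-- `π : X → ℙ^{n-1}` is flat, i.e. no fibre is two-dimensional: `g` does not
vanish identically on any fibre of the ambient bundle.  Together with smoothness
of `X` this renders a *standard* conic bundle. -/
def ProjectionIsFlat {n m : ℕ} (g : Cox K n m) : Prop :=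
  ∀ u : Fin n → K, u ≠ 0 → ∃ v : Fin m → K, evalPt K (u, v) g ≠ 0

end

end ConicBundleFormalization

namespace ConicBundleFormalization

noncomputable section

variable (K : Type) [Field K]

/-! ### The special members `a x² + b y² + c z² + f x y` and the associated double
cover data in characteristic 2 -/

/-- The special member `X = {a x² + b y² + c z² + f x y = 0}` of
`|𝒪_P(λ+μ+ν, 2)|`, `P = P_n(λ,μ,ν)`, built from a quadruple `(a,b,c,f)` of
polynomials on the base (equation (3.1) of the paper). -/
def specialMemberX {n : ℕ} (abcf : Fin 4 → MvPolynomial (Fin n) K) : Cox K n 3 :=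
  rename Sum.inl (abcf 0) * X (Sum.inr 0) ^ 2 +
  rename Sum.inl (abcf 1) * X (Sum.inr 1) ^ 2 +
  rename Sum.inl (abcf 2) * X (Sum.inr 2) ^ 2 +
  rename Sum.inl (abcf 3) * X (Sum.inr 0) * X (Sum.inr 1)

/-- The hypersurface `Z = {a x² + b y² + c z̄ + f x y = 0}` in the
`ℙ(1,1,2)`-bundle `R` over `ℙ^{n-1}` (with `z̄` the third fibre variable, of
weight 2), the image of `X` under the purely inseparable double cover `P → R` in
characteristic 2. -/
def specialMemberZ {n : ℕ} (abcf : Fin 4 → MvPolynomial (Fin n) K) : Cox K n 3 :=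
  rename Sum.inl (abcf 0) * X (Sum.inr 0) ^ 2 +
  rename Sum.inl (abcf 1) * X (Sum.inr 1) ^ 2 +
  rename Sum.inl (abcf 2) * X (Sum.inr 2) +
  rename Sum.inl (abcf 3) * X (Sum.inr 0) * X (Sum.inr 1)

/-! ### Admissible critical points (Definition 3.5 of the paper) -/

/-- A polynomial `F` in `N` variables over a field of characteristic 2 is in
*admissible normal form* at the origin: its linear part vanishes (a critical
point) and, up to an additive constant and higher-order terms,
`F = α + x₀x₁ + x₂x₃ + ⋯ + x_{N-2}x_{N-1}` if `N` is even, and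
`F = α + βx₀² + x₁x₂ + ⋯ + x_{N-2}x_{N-1} + (nonzero)·x₀³ + ⋯` if `N` is odd. -/
def AdmissibleNormalForm {N : ℕ} (F : MvPolynomial (Fin N) K) : Prop :=
  (∀ i, F.coeff (Finsupp.single i 1) = 0) ∧
  (N % 2 = 0 →
    (∀ i, F.coeff (Finsupp.single i 2) = 0) ∧
    (∀ i j : Fin N, (i : ℕ) < (j : ℕ) →
      F.coeff (Finsupp.single i 1 + Finsupp.single j 1) =
        (if (i : ℕ) % 2 = 0 ∧ (j : ℕ) = (i : ℕ) + 1 then 1 else 0))) ∧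
  (N % 2 = 1 →
    (∀ i : Fin N, (i : ℕ) ≠ 0 → F.coeff (Finsupp.single i 2) = 0) ∧
    (∀ i j : Fin N, (i : ℕ) < (j : ℕ) →
      F.coeff (Finsupp.single i 1 + Finsupp.single j 1) =
        (if (i : ℕ) % 2 = 1 ∧ (j : ℕ) = (i : ℕ) + 1 then 1 else 0)) ∧
    (∀ h0 : 0 < N, F.coeff (Finsupp.single (⟨0, h0⟩ : Fin N) 3) ≠ 0))

/-- A local function `F` (a polynomial in the local coordinates indexed by `ι`,
centred at the origin) has an *admissible critical point* at the origin: after a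
suitable (linear) change of coordinates it is in admissible normal form. -/
def AdmissibleLocalFunction {ι : Type} [Fintype ι] (F : MvPolynomial ι K) : Prop :=
  ∃ (N : ℕ) (e : ι ≃ Fin N) (T : Matrix (Fin N) (Fin N) K), IsUnit T.det ∧
    AdmissibleNormalForm K
      ((aeval (fun i : ι => ∑ j : Fin N, MvPolynomial.C (T (e i) j) * X j)) F)

/-- The local expression of the section `z̄` of `𝓛²` on the chart `x = 1` of `Z`
(multiplied by the square unit `c̃²`, i.e. computed with respect to the local
generator `c̃·ξ` of `𝓛`): the polynomial `c·(a + b·y² + f·y)` in the base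
variables and the remaining fibre variable `y`. -/
def chartPolyX {n : ℕ} (abcf : Fin 4 → MvPolynomial (Fin n) K) :
    MvPolynomial (Fin n ⊕ Fin 1) K :=
  rename Sum.inl (abcf 2) *
    (rename Sum.inl (abcf 0) + rename Sum.inl (abcf 1) * X (Sum.inr 0) ^ 2 +
      rename Sum.inl (abcf 3) * X (Sum.inr 0))

/-- The local expression of the section `z̄` on the chart `y = 1` of `Z`:
the polynomial `c·(a·x² + b + f·x)`. -/
def chartPolyY {n : ℕ} (abcf : Fin 4 → MvPolynomial (Fin n) K) :
    MvPolynomial (Fin n ⊕ Fin 1) K :=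
  rename Sum.inl (abcf 2) *
    (rename Sum.inl (abcf 0) * X (Sum.inr 0) ^ 2 + rename Sum.inl (abcf 1) +
      rename Sum.inl (abcf 3) * X (Sum.inr 0))

/-- Translation of a chart polynomial to local coordinates centred at the point
with base coordinates `u0` (normalized by `u0 i0 = 1`) and fibre coordinate `y0`:
substitute `u_{i0} ↦ 1`, `u_j ↦ u_j + u0 j` and `y ↦ y + y0`.  The variables are
the genuine local coordinates `{u_j : j ≠ i0} ∪ {y}` of `Z` at that point. -/
def localAt {n : ℕ} (i0 : Fin n) (u0 : Fin n → K) (y0 : K)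
    (G : MvPolynomial (Fin n ⊕ Fin 1) K) :
    MvPolynomial ({ j : Fin n // j ≠ i0 } ⊕ Fin 1) K :=
  aeval (Sum.elim
    (fun j => if h : j = i0 then 1 else X (Sum.inl ⟨j, h⟩) + MvPolynomial.C (u0 j))
    (fun _ => X (Sum.inr 0) + MvPolynomial.C y0)) G

/-- The section `z̄` of `𝓛²` on `Z = {gZ = 0}` has a *critical point* at the point
below the normalized cone point `p` (with `u_{i0} = 1` and the fibre coordinate
`jfix ∈ {x, y}` normalized to 1): the differential of `z̄` vanishes on the tangent
space of `Z` at that point, i.e. every chart tangent vector `t` of `Z` has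
vanishing `z̄`-component. -/
def CriticalPointOfZbar {n : ℕ} (gZ : Cox K n 3) (i0 : Fin n) (jfix : Fin 3)
    (p : Pt K n 3) : Prop :=
  ∀ t : (Fin n ⊕ Fin 3) → K, t (Sum.inl i0) = 0 → t (Sum.inr jfix) = 0 →
    (∑ v : Fin n ⊕ Fin 3, t v * evalPt K p (pderiv v gZ)) = 0 →
    t (Sum.inr 2) = 0

/-- `p` is a singular point of the cone over `X = {g = 0}`. -/
def SingularConePoint {n m : ℕ} (g : Cox K n m) (p : Pt K n m) : Prop :=
  p ∈ XCone K g ∧ ∀ v : Fin n ⊕ Fin m, evalPt K p (pderiv v g) = 0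

end

end ConicBundleFormalization

namespace ConicBundleFormalization

open MvPolynomial


theorem dep_aux {K : Type} [Field K] {σ τ : Type} [Fintype σ] [Fintype τ]
    (h : Fintype.card τ < Fintype.card σ) (φ : σ → MvPolynomial τ K) :
    ∃ D : MvPolynomial σ K, D ≠ 0 ∧ aeval φ D = 0 := by
  by_contra hc
  push Not at hc
  have hi : AlgebraicIndependent K φ := by
    rw [algebraicIndependent_iff]
    intro D hD
    by_contra h0
    exact hc D h0 hD
  have := hi.cardinalMk_le_trdeg
  rw [MvPolynomial.trdeg_of_isDomain] at this
  simp at this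
  omega

theorem eval_aeval_aux {K : Type} [Field K] {σ τ : Type} (t : τ → K)
    (φ : σ → MvPolynomial τ K) (D : MvPolynomial σ K) :
    eval t (aeval φ D) = eval (fun s => eval t (φ s)) D := by
  rw [← coe_aeval_eq_eval, ← coe_aeval_eq_eval]
  simp only [RingHom.coe_coe]
  rw [comp_aeval_apply]

theorem dep_main {K : Type} [Field K] {σ ι κ : Type} [Fintype σ] [Fintype ι] [Fintype κ]
    (e : κ → σ) (he : Function.Injective e) (h : Fintype.card ι < Fintype.card κ)
    (ψ : κ → MvPolynomial (σ ⊕ ι) K) :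
    ∃ D : MvPolynomial σ K, D ≠ 0 ∧ ∀ (p p' : σ → K) (q : ι → K),
      (∀ k, p' (e k) = 0) → (∀ s, (∀ k, e k ≠ s) → p' s = p s) →
      (∀ k, p (e k) = eval (Sum.elim p' q) (ψ k)) → eval p D = 0 := by
  classical
  let R := {s : σ // ∀ k, e k ≠ s}
  have hcard : Fintype.card (R ⊕ ι) < Fintype.card σ := by
    have h1 : Fintype.card (R ⊕ κ) ≤ Fintype.card σ := by
      apply Fintype.card_le_of_injective (Sum.elim Subtype.val e)
      rintro (⟨a, ha⟩ | a) (⟨b, hb⟩ | b) hab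
      · simpa using hab
      · exact absurd hab.symm (ha b)
      · exact absurd hab (hb a)
      · simpa using he hab
    rw [Fintype.card_sum] at h1 ⊢
    omega
  let ext : σ ⊕ ι → MvPolynomial (R ⊕ ι) K :=
    Sum.elim (fun s => if h : ∀ k, e k ≠ s then X (Sum.inl ⟨s, h⟩) else 0) (fun i => X (Sum.inr i))
  let φ : σ → MvPolynomial (R ⊕ ι) K := fun s =>
    if h : ∀ k, e k ≠ s then X (Sum.inl ⟨s, h⟩) else
      aeval ext (ψ (Classical.choose (not_forall.1 h)))
  obtain ⟨D, hD, hD0⟩ := dep_aux hcard φ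
  refine ⟨D, hD, fun p p' q h0 h1 h2 => ?_⟩
  let t : R ⊕ ι → K := Sum.elim (fun s => p s.1) q
  have hext : (fun x => eval t (ext x)) = Sum.elim p' q := by
    funext x
    rcases x with s | i
    · by_cases hs : ∀ k, e k ≠ s
      · simp [ext, hs, t, h1 s hs]
      · simp only [ext, Sum.elim_inl, dif_neg hs, map_zero]
        push Not at hs
        obtain ⟨k, rfl⟩ := hs
        exact (h0 k).symm
    · simp [ext, t]
  have hev : ∀ P : MvPolynomial (σ ⊕ ι) K, eval t (aeval ext P) = eval (Sum.elim p' q) P := by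
    intro P
    rw [← hext, eval_aeval_aux]
  have hφ : (fun s => eval t (φ s)) = p := by
    funext s
    by_cases hs : ∀ k, e k ≠ s
    · simp [φ, hs, t]
    · simp only [φ, dif_neg hs]
      rw [hev, ← h2]
      congr 1
      simpa using Classical.choose_spec (not_forall.1 hs)
  have := congrArg (eval t) hD0
  rw [eval_aeval_aux, hφ, map_zero] at this
  exact this

/-- index type of the parameters -/
abbrev Par (n : ℕ) (d : Fin 4 → ℕ) : Type :=
  Σ i : Fin 4, {e : Fin n →₀ ℕ // e ∈ Finset.finsuppAntidiag (Finset.univ : Finset (Fin n)) (d i)}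

noncomputable def GG {K : Type} [Field K] {n : ℕ} {d : Fin 4 → ℕ} (p : Par n d → K) (i : Fin 4) :
    MvPolynomial (Fin n) K :=
  ∑ s : Par n d, if s.1 = i then C (p s) * monomial s.2.1 1 else 0

theorem GG_coeff {K : Type} [Field K] {n : ℕ} {d : Fin 4 → ℕ} (p : Par n d → K) (s : Par n d) :
    (GG p s.1).coeff s.2.1 = p s := by
  classical
  rw [GG, coeff_sum, Finset.sum_eq_single s]
  · simp
  · rintro ⟨i, e, he⟩ _ hb
    obtain ⟨j, e', he'⟩ := s
    split_ifs with h
    · simp only at h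
      subst h
      rw [coeff_C_mul, coeff_monomial, if_neg, mul_zero]
      rintro rfl
      exact hb rfl
    · simp
  · simp

theorem GG_coeff_zero {K : Type} [Field K] {n : ℕ} {d : Fin 4 → ℕ} (p : Par n d → K) (i : Fin 4)
    (e : Fin n →₀ ℕ) (he : ∑ j, e j ≠ d i) :
    (GG p i).coeff e = 0 := by
  classical
  rw [GG, coeff_sum]
  apply Finset.sum_eq_zero
  rintro ⟨j, e', he'⟩ _
  split_ifs with h
  · simp only at h
    subst h
    rw [coeff_C_mul, coeff_monomial, if_neg, mul_zero]
    rintro rfl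
    simp at he'
    exact he he'
  · simp

theorem eval_GG {K : Type} [Field K] {n : ℕ} {d : Fin 4 → ℕ} (p : Par n d → K) (i : Fin 4)
    (u : Fin n → K) :
    eval u (GG p i) = ∑ s : Par n d, p s * (if s.1 = i then eval u (monomial s.2.1 1) else 0) := by
  rw [GG, map_sum]
  refine Finset.sum_congr rfl fun s _ => ?_
  split_ifs <;> simp

theorem eval_pderiv_GG {K : Type} [Field K] {n : ℕ} {d : Fin 4 → ℕ} (p : Par n d → K) (i : Fin 4)
    (u : Fin n → K) (k : Fin n) :
    eval u (pderiv k (GG p i)) =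
      ∑ s : Par n d, p s * (if s.1 = i then eval u (pderiv k (monomial s.2.1 1)) else 0) := by
  rw [GG, map_sum, map_sum]
  refine Finset.sum_congr rfl fun s _ => ?_
  split_ifs
  · rw [pderiv_C_mul, map_mul, eval_C]
  · simp

theorem eval_smul_mono {K : Type} [Field K] {n : ℕ} (e : Fin n →₀ ℕ) (s : K) (u : Fin n → K) :
    eval (fun j => s * u j) (monomial e 1) = s ^ (∑ j, e j) * eval u (monomial e (1 : K)) := by
  rw [eval_monomial, eval_monomial, Finsupp.prod_fintype _ _ (by simp),
    Finsupp.prod_fintype _ _ (by simp)]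
  simp [mul_pow, Finset.prod_mul_distrib, Finset.prod_pow_eq_pow_sum]

theorem eval_smul_GG {K : Type} [Field K] {n : ℕ} {d : Fin 4 → ℕ} (p : Par n d → K) (i : Fin 4)
    (s : K) (u : Fin n → K) :
    eval (fun j => s * u j) (GG p i) = s ^ d i * eval u (GG p i) := by
  rw [eval_GG, eval_GG, Finset.mul_sum]
  refine Finset.sum_congr rfl fun t _ => ?_
  split_ifs with h
  · have := (Finset.mem_finsuppAntidiag.1 t.2.2).1
    have h' : d t.1 = d i := by rw [h]
    rw [eval_smul_mono, this.trans h']; ring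
  · simp

theorem eval_smul_pderiv_GG {K : Type} [Field K] {n : ℕ} {d : Fin 4 → ℕ} (p : Par n d → K)
    (i : Fin 4) (s : K) (u : Fin n → K) (k : Fin n) :
    s * eval (fun j => s * u j) (pderiv k (GG p i)) = s ^ d i * eval u (pderiv k (GG p i)) := by
  rw [eval_pderiv_GG, eval_pderiv_GG, Finset.mul_sum, Finset.mul_sum]
  refine Finset.sum_congr rfl fun t _ => ?_
  split_ifs with h
  · obtain ⟨i', e, he⟩ := t
    simp only at h
    subst h
    simp at he
    rw [pderiv_monomial]
    by_cases h0 : e k = 0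
    · simp [h0]
    have h1 : e = (e - Finsupp.single k 1) + Finsupp.single k 1 := by
      ext j
      by_cases hj : k = j
      · subst hj; simp; omega
      · simp [Finsupp.single_apply, hj]
    have h2 : d i' = ∑ j, (e - Finsupp.single k 1 : Fin n →₀ ℕ) j + 1 := by
      rw [← he]
      conv_lhs => rw [h1]
      rw [← Finsupp.degree_eq_sum, ← Finsupp.degree_eq_sum, map_add, Finsupp.degree_single]
    have h3 : monomial (e - Finsupp.single k 1) (1 * (e k : K))
        = C (e k : K) * monomial (e - Finsupp.single k 1) (1 : K) := by
      rw [C_mul_monomial, mul_comm]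
    have h4 : s ^ d i' = s ^ (∑ j, (e - Finsupp.single k 1 : Fin n →₀ ℕ) j) * s := by
      rw [h2, pow_succ]
    rw [h3, map_mul, map_mul, eval_smul_mono, eval_C, eval_C, h4]
    ring
  · simp

/-- jet monomial -/
noncomputable def EE {n : ℕ} (i0 : Fin n) (m : ℕ) (j : Fin n) : Fin n →₀ ℕ :=
  Finsupp.single i0 (m - 1) + Finsupp.single j 1

theorem EE_mem {n : ℕ} (i0 : Fin n) (m : ℕ) (j : Fin n) (hm : 1 ≤ m) :
    EE i0 m j ∈ Finset.finsuppAntidiag (Finset.univ : Finset (Fin n)) m := by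
  rw [Finset.mem_finsuppAntidiag]
  refine ⟨?_, by simp⟩
  rw [← Finsupp.degree_eq_sum, EE, map_add, Finsupp.degree_single, Finsupp.degree_single]
  omega

theorem S0_mem {n : ℕ} (i0 : Fin n) (m : ℕ) :
    Finsupp.single i0 m ∈ Finset.finsuppAntidiag (Finset.univ : Finset (Fin n)) m := by
  simp [Finsupp.single_apply]

theorem eval_EE {K : Type} [Field K] {n : ℕ} (i0 : Fin n) (m : ℕ) (j : Fin n) (u : Fin n → K)
    (hu : u i0 = 1) : eval u (monomial (EE i0 m j) (1 : K)) = u j := by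
  have : monomial (EE i0 m j) (1 : K) = X i0 ^ (m - 1) * X j := by
    rw [EE, monomial_add_single, pow_one, X_pow_eq_monomial]
  rw [this]; simp [hu]

theorem eval_pderiv_EE {K : Type} [Field K] {n : ℕ} (i0 : Fin n) (m : ℕ) (j k : Fin n)
    (u : Fin n → K) (hk : k ≠ i0)
    (hu : u i0 = 1) :
    eval u (pderiv k (monomial (EE i0 m j) (1 : K))) = if j = k then 1 else 0 := by
  classical
  have : monomial (EE i0 m j) (1 : K) = X i0 ^ (m - 1) * X j := by
    rw [EE, monomial_add_single, pow_one, X_pow_eq_monomial]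
  rw [this, pderiv_mul, pderiv_pow, pderiv_X_of_ne hk.symm]
  by_cases h : j = k
  · subst h; simp [hu]
  · simp [h]

theorem eval_S0 {K : Type} [Field K] {n : ℕ} (i0 : Fin n) (m : ℕ) (u : Fin n → K)
    (hu : u i0 = 1) : eval u (monomial (Finsupp.single i0 m) (1 : K)) = 1 := by
  rw [← X_pow_eq_monomial]; simp [hu]

theorem eval_pderiv_S0 {K : Type} [Field K] {n : ℕ} (i0 : Fin n) (m : ℕ) (k : Fin n)
    (u : Fin n → K) (hk : k ≠ i0) :
    eval u (pderiv k (monomial (Finsupp.single i0 m) (1 : K))) = 0 := by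
  rw [← X_pow_eq_monomial, pderiv_pow, pderiv_X_of_ne hk.symm]; simp

/-- solved parameters -/
noncomputable def solved {n : ℕ} (d : Fin 4 → ℕ) (i0 : Fin n) (α : Fin 4) (hα : 1 ≤ d α)
    (Z : Finset (Fin 4)) : Fin n ⊕ {β // β ∈ Z} → Par n d :=
  Sum.elim (fun j => ⟨α, EE i0 (d α) j, EE_mem i0 _ j hα⟩)
    (fun β => ⟨β.1, Finsupp.single i0 (d β.1), S0_mem i0 _⟩)

theorem solved_inj {n : ℕ} (d : Fin 4 → ℕ) (i0 : Fin n) (α : Fin 4) (hα : 1 ≤ d α)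
    (Z : Finset (Fin 4)) (hZ : α ∉ Z) : Function.Injective (solved d i0 α hα Z) := by
  rintro (a | ⟨a, ha⟩) (b | ⟨b, hb⟩) hab
  · simp only [solved, Sum.elim_inl, Sigma.mk.injEq, heq_eq_eq, true_and, Subtype.mk.injEq] at hab
    have := add_left_cancel hab
    rw [Finsupp.single_left_inj one_ne_zero] at this
    rw [this]
  · have := congrArg Sigma.fst hab
    simp only [solved, Sum.elim_inl, Sum.elim_inr] at this
    exact absurd (this ▸ hb) hZ
  · have := congrArg Sigma.fst hab
    simp only [solved, Sum.elim_inl, Sum.elim_inr] at this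
    exact absurd (this ▸ ha) hZ
  · have := congrArg Sigma.fst hab
    simp only [solved, Sum.elim_inr] at this
    subst this; rfl

theorem sum_split {K σ κ : Type} [Field K] [Fintype σ] [Fintype κ]
    (e : κ → σ) (he : Function.Injective e) (p p' w : σ → K)
    (h0 : ∀ k, p' (e k) = 0) (h1 : ∀ s, (∀ k, e k ≠ s) → p' s = p s) :
    ∑ s, p s * w s = ∑ s, p' s * w s + ∑ k, p (e k) * w (e k) := by
  classical
  have : ∑ k, p (e k) * w (e k) = ∑ s ∈ Finset.univ.image e, p s * w s := by
    rw [Finset.sum_image (fun a _ b _ h => he h)]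
  rw [this, ← Finset.sum_add_sum_compl (Finset.univ.image e) (fun s => p s * w s),
    ← Finset.sum_add_sum_compl (Finset.univ.image e) (fun s => p' s * w s)]
  have e1 : ∑ s ∈ Finset.univ.image e, p' s * w s = 0 := by
    rw [Finset.sum_image (fun a _ b _ h => he h)]
    simp [h0]
  have e2 : ∑ s ∈ (Finset.univ.image e)ᶜ, p' s * w s = ∑ s ∈ (Finset.univ.image e)ᶜ, p s * w s := by
    refine Finset.sum_congr rfl fun s hs => ?_
    rw [h1 s (by simpa using hs)]
  rw [e1, e2]; ring

theorem F1 {K : Type} [Field K] {n : ℕ} (d : Fin 4 → ℕ) (i0 : Fin n) (α : Fin 4) (hα : 1 ≤ d α)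
    (Z : Finset (Fin 4)) (hZ : α ∉ Z) (p p' : Par n d → K)
    (h0 : ∀ k, p' (solved d i0 α hα Z k) = 0)
    (h1 : ∀ s, (∀ k, solved d i0 α hα Z k ≠ s) → p' s = p s)
    (u : Fin n → K) (hu : u i0 = 1) (γ : Fin 4) :
    eval u (GG p γ) = eval u (GG p' γ)
      + (if α = γ then ∑ j, p (solved d i0 α hα Z (Sum.inl j)) * u j else 0)
      + (∑ β : {β // β ∈ Z}, if β.1 = γ then p (solved d i0 α hα Z (Sum.inr β)) else 0) := by
  rw [eval_GG, eval_GG, sum_split _ (solved_inj d i0 α hα Z hZ) p p' _ h0 h1,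
    Fintype.sum_sum_type, add_assoc]
  congr 2
  · split_ifs with h
    · refine Finset.sum_congr rfl fun j _ => ?_
      simp [solved, h, eval_EE, hu]
    · simp [solved, h]
  · refine Finset.sum_congr rfl fun j _ => ?_
    by_cases h : j.1 = γ <;> simp [solved, h, eval_S0, hu]

theorem F2 {K : Type} [Field K] {n : ℕ} (d : Fin 4 → ℕ) (i0 : Fin n) (α : Fin 4) (hα : 1 ≤ d α)
    (Z : Finset (Fin 4)) (hZ : α ∉ Z) (p p' : Par n d → K)
    (h0 : ∀ k, p' (solved d i0 α hα Z k) = 0)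
    (h1 : ∀ s, (∀ k, solved d i0 α hα Z k ≠ s) → p' s = p s)
    (u : Fin n → K) (hu : u i0 = 1) (γ : Fin 4) (k : Fin n) (hk : k ≠ i0) :
    eval u (pderiv k (GG p γ)) = eval u (pderiv k (GG p' γ))
      + (if α = γ then p (solved d i0 α hα Z (Sum.inl k)) else 0) := by
  rw [eval_pderiv_GG, eval_pderiv_GG, sum_split _ (solved_inj d i0 α hα Z hZ) p p' _ h0 h1,
    Fintype.sum_sum_type]
  congr 1
  have e2 : ∀ β : {β // β ∈ Z}, eval u (pderiv k (monomial
      (solved d i0 α hα Z (Sum.inr β)).2.1 (1 : K))) = 0 := fun β => eval_pderiv_S0 i0 _ k u hk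
  have e1 : ∀ j, eval u (pderiv k (monomial
      (solved d i0 α hα Z (Sum.inl j)).2.1 (1 : K))) = if j = k then 1 else 0 :=
    fun β => eval_pderiv_EE i0 _ _ k u hk hu
  simp only [e1, e2, ite_self, mul_zero, Finset.sum_const_zero, add_zero]
  by_cases h : α = γ
  · simp [solved, h]
  · simp [solved, h, ite_self]

theorem stratum {K : Type} [Field K] {n : ℕ} (d : Fin 4 → ℕ) (i0 : Fin n) (α : Fin 4)
    (hα : 1 ≤ d α) (Z : Finset (Fin 4)) (hZ : α ∉ Z) (m : ℕ) (hm : m ≤ Z.card)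
    (V : Fin 4 → MvPolynomial (Fin 4 ⊕ Fin m) K) (W : MvPolynomial (Fin 4 ⊕ Fin m) K) :
    ∃ D : MvPolynomial (Par n d) K, D ≠ 0 ∧ ∀ (p : Par n d → K) (u : Fin n → K) (r : Fin m → K),
      u i0 = 1 →
      (∀ β, β = α ∨ β ∈ Z → eval u (GG p β) =
        eval (Sum.elim (fun γ => if γ = α ∨ γ ∈ Z then 0 else eval u (GG p γ)) r) (V β)) →
      (∀ k, k ≠ i0 → eval u (pderiv k (GG p α)) =
        eval (Sum.elim (fun γ => if γ = α then 0 else eval u (pderiv k (GG p γ))) r) W) →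
      eval p D = 0 := by
  classical
  let ι := {j : Fin n // j ≠ i0} ⊕ Fin m
  let R := MvPolynomial (Par n d ⊕ ι) K
  let U : Fin n → R := fun j => if h : j = i0 then 1 else X (Sum.inr (Sum.inl ⟨j, h⟩))
  let GP : Fin 4 → R := fun i =>
    ∑ s : Par n d, X (Sum.inl s) * (if s.1 = i then aeval U (monomial s.2.1 (1 : K)) else 0)
  let DP : Fin n → Fin 4 → R := fun k i =>
    ∑ s : Par n d, X (Sum.inl s) * (if s.1 = i then aeval U (pderiv k (monomial s.2.1 (1 : K))) else 0)
  let VP : Fin 4 → R := fun β => aeval (Sum.elim (fun γ => if γ = α ∨ γ ∈ Z then 0 else GP γ)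
    (fun t => X (Sum.inr (Sum.inr t)))) (V β)
  let AP : Fin n → R := fun k => aeval (Sum.elim (fun γ => if γ = α then 0 else DP k γ)
    (fun t => X (Sum.inr (Sum.inr t)))) W - DP k α
  let ψ : Fin n ⊕ {β // β ∈ Z} → R := Sum.elim
    (fun k => if k = i0 then VP α - GP α - ∑ j ∈ Finset.univ.erase i0, AP j * U j else AP k)
    (fun β => VP β.1 - GP β.1)
  have hcard : Fintype.card ι < Fintype.card (Fin n ⊕ {β // β ∈ Z}) := by
    have : Fintype.card {j : Fin n // j ≠ i0} = n - 1 := by simp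
    have h2 := i0.pos
    simp only [ι, Fintype.card_sum, this, Fintype.card_fin, Fintype.card_coe]
    omega
  obtain ⟨D, hD, hD0⟩ := dep_main (solved d i0 α hα Z) (solved_inj d i0 α hα Z hZ) hcard ψ
  refine ⟨D, hD, fun p u r hu hV hW => ?_⟩
  let p' : Par n d → K := fun s => if ∃ k, solved d i0 α hα Z k = s then 0 else p s
  have h0 : ∀ k, p' (solved d i0 α hα Z k) = 0 := fun k => if_pos ⟨k, rfl⟩
  have h1 : ∀ s, (∀ k, solved d i0 α hα Z k ≠ s) → p' s = p s :=
    fun s hs => if_neg (by push Not; exact hs)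
  let q : ι → K := Sum.elim (fun j => u j.1) r
  let t : Par n d ⊕ ι → K := Sum.elim p' q
  have f1 := F1 d i0 α hα Z hZ p p' h0 h1 u hu
  have f2 := F2 d i0 α hα Z hZ p p' h0 h1 u hu
  have hU : ∀ j, eval t (U j) = u j := by
    intro j
    by_cases h : j = i0
    · subst h; simp [U, hu]
    · simp [U, h, t, q]
  have hU' : (fun j => eval t (U j)) = u := funext hU
  have hGP : ∀ i, eval t (GP i) = eval u (GG p' i) := by
    intro i
    rw [eval_GG, map_sum]
    refine Finset.sum_congr rfl fun s _ => ?_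
    split_ifs
    · rw [map_mul, eval_aeval_aux, hU', eval_X]; rfl
    · simp
  have hDP : ∀ k i, eval t (DP k i) = eval u (pderiv k (GG p' i)) := by
    intro k i
    rw [eval_pderiv_GG, map_sum]
    refine Finset.sum_congr rfl fun s _ => ?_
    split_ifs
    · rw [map_mul, eval_aeval_aux, hU', eval_X]; rfl
    · simp
  have hVP : ∀ β, β = α ∨ β ∈ Z → eval t (VP β) = eval u (GG p β) := by
    intro β hβ
    rw [hV β hβ]
    simp only [VP]
    rw [eval_aeval_aux]
    congr 2
    funext x
    rcases x with γ | y
    · simp only [Sum.elim_inl]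
      split_ifs with h
      · simp
      · push Not at h
        rw [hGP, f1 γ, if_neg (Ne.symm h.1), Finset.sum_eq_zero]
        · simp
        · rintro ⟨b, hb⟩ _
          rw [if_neg]
          rintro rfl
          exact h.2 hb
    · simp [t, q]
  have hAP : ∀ k, k ≠ i0 → eval t (AP k) = p (solved d i0 α hα Z (Sum.inl k)) := by
    intro k hk
    have e1 := hW k hk
    have e2 := f2 α k hk
    rw [if_pos rfl, e1] at e2
    rw [← sub_eq_iff_eq_add'] at e2
    rw [← e2]
    simp only [AP]
    rw [map_sub, hDP, eval_aeval_aux]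
    congr 3
    funext x
    rcases x with γ | y
    · simp only [Sum.elim_inl]
      split_ifs with h
      · simp
      · rw [hDP, f2 γ k hk, if_neg (Ne.symm h)]; simp
    · simp [t, q]
  refine hD0 p p' q h0 h1 ?_
  change ∀ k, _ = eval t (ψ k)
  rintro (k | ⟨β, hβ⟩)
  · by_cases hk : k = i0
    · subst hk
      have e1 := f1 α
      rw [if_pos rfl, Finset.sum_eq_zero (s := Finset.univ (α := {β // β ∈ Z})),
        ← Finset.add_sum_erase _ _ (Finset.mem_univ k), hu] at e1
      · simp only [ψ, Sum.elim_inl, if_true]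
        rw [map_sub, map_sub, hVP α (Or.inl rfl), hGP, e1, map_sum]
        have : ∑ j ∈ Finset.univ.erase k, eval t (AP j * U j) =
            ∑ j ∈ Finset.univ.erase k, p (solved d k α hα Z (Sum.inl j)) * u j := by
          refine Finset.sum_congr rfl fun j hj => ?_
          rw [map_mul, hU, hAP j (Finset.ne_of_mem_erase hj)]
        rw [this]
        ring
      · rintro ⟨b, hb⟩ _
        rw [if_neg]
        rintro rfl
        exact hZ hb
    · simp only [ψ, Sum.elim_inl, if_neg hk]
      exact (hAP k hk).symm
  · simp only [ψ, Sum.elim_inr]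
    rw [map_sub, hVP β (Or.inr hβ), hGP, f1 β, if_neg (by rintro rfl; exact hZ hβ),
      Finset.sum_eq_single ⟨β, hβ⟩]
    · simp
    · rintro ⟨b, hb⟩ _ hne
      rw [if_neg]
      rintro rfl
      exact hne rfl
    · simp

theorem stratum1 {K : Type} [Field K] {n : ℕ} (d : Fin 4 → ℕ) (i0 : Fin n) (α : Fin 4)
    (hα : 1 ≤ d α) :
    ∃ D : MvPolynomial (Par n d) K, D ≠ 0 ∧ ∀ (p : Par n d → K) (u : Fin n → K),
      u i0 = 1 → eval u (GG p α) = 0 → (∀ k, k ≠ i0 → eval u (pderiv k (GG p α)) = 0) →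
      eval p D = 0 := by
  obtain ⟨D, hD, h⟩ := stratum (K := K) d i0 α hα ∅ (by simp) 0 (by simp) (fun _ => 0) 0
  refine ⟨D, hD, fun p u hu h1 h2 => h p u (fun _ => 0) hu ?_ ?_⟩
  · rintro β (rfl | hβ)
    · simp [h1]
    · simp at hβ
  · intro k hk; simp [h2 k hk]

theorem stratum1' {K : Type} [Field K] {n : ℕ} (d : Fin 4 → ℕ) (i0 : Fin n) (α : Fin 4) :
    ∃ D : MvPolynomial (Par n d) K, D ≠ 0 ∧ ∀ (p : Par n d → K) (u : Fin n → K),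
      u i0 = 1 → eval u (GG p α) = 0 → (∀ k, k ≠ i0 → eval u (pderiv k (GG p α)) = 0) →
      eval p D = 0 := by
  by_cases hα : 1 ≤ d α
  · exact stratum1 d i0 α hα
  have h0 : d α = 0 := by omega
  refine ⟨X ⟨α, 0, by simp [h0]⟩, X_ne_zero _, fun p u hu h1 _ => ?_⟩
  rw [eval_GG, Finset.sum_eq_single ⟨α, 0, by simp [h0]⟩] at h1
  · simpa using h1
  · rintro ⟨i, e, he⟩ _ hb
    rw [if_neg, mul_zero]
    rintro h
    simp only at h
    subst h
    simp [h0] at he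
    subst he
    exact hb rfl
  · simp

theorem stratum2 {K : Type} [Field K] {n : ℕ} (d : Fin 4 → ℕ) (i0 : Fin n)
    (hα : 1 ≤ d 0) :
    ∃ D : MvPolynomial (Par n d) K, D ≠ 0 ∧ ∀ (p : Par n d → K) (u : Fin n → K) (y : K),
      u i0 = 1 → eval u (GG p 0) = eval u (GG p 1) * y ^ 2 →
      eval u (GG p 3) = - 2 * eval u (GG p 1) * y →
      (∀ k, k ≠ i0 → eval u (pderiv k (GG p 0)) = -(y ^ 2 * eval u (pderiv k (GG p 1))
        + y * eval u (pderiv k (GG p 3)))) →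
      eval p D = 0 := by
  obtain ⟨D, hD, h⟩ := stratum (K := K) d i0 0 hα {3} (by simp) 1 (by simp)
    (fun β => if β = 0 then X (Sum.inl 1) * X (Sum.inr 0) ^ 2 else
      C (-2) * X (Sum.inl 1) * X (Sum.inr 0))
    (-(X (Sum.inr 0) ^ 2 * X (Sum.inl 1) + X (Sum.inr 0) * X (Sum.inl 3)))
  refine ⟨D, hD, fun p u y hu h1 h2 h3 => h p u (fun _ => y) hu ?_ ?_⟩
  · rintro β (rfl | hβ)
    · simp [h1]
    · simp only [Finset.mem_singleton] at hβ
      subst hβ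
      simp [h2]
  · intro k hk; simp [h3 k hk]

theorem stratum4 {K : Type} [Field K] {n : ℕ} (d : Fin 4 → ℕ) (i0 : Fin n)
    (hα : 1 ≤ d 0) :
    ∃ D : MvPolynomial (Par n d) K, D ≠ 0 ∧ ∀ (p : Par n d → K) (u : Fin n → K) (y z : K),
      u i0 = 1 → eval u (GG p 0) = eval u (GG p 1) * y ^ 2 →
      eval u (GG p 3) = - 2 * eval u (GG p 1) * y → eval u (GG p 2) = 0 →
      (∀ k, k ≠ i0 → eval u (pderiv k (GG p 0)) = -(y ^ 2 * eval u (pderiv k (GG p 1))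
        + y * eval u (pderiv k (GG p 3)) + z ^ 2 * eval u (pderiv k (GG p 2)))) →
      eval p D = 0 := by
  obtain ⟨D, hD, h⟩ := stratum (K := K) d i0 0 hα {3, 2} (by simp) 2 (by simp)
    (fun β => if β = 0 then X (Sum.inl 1) * X (Sum.inr 0) ^ 2 else if β = 3 then
      C (-2) * X (Sum.inl 1) * X (Sum.inr 0) else 0)
    (-(X (Sum.inr 0) ^ 2 * X (Sum.inl 1) + X (Sum.inr 0) * X (Sum.inl 3)
      + X (Sum.inr 1) ^ 2 * X (Sum.inl 2)))
  refine ⟨D, hD, fun p u y z hu h1 h2 h4 h3 => h p u ![y, z] hu ?_ ?_⟩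
  · rintro β (rfl | hβ)
    · simp [h1]
    · simp only [Finset.mem_singleton, Finset.mem_insert] at hβ
      rcases hβ with rfl | rfl
      · simp [h2]
      · simp [h4]
  · intro k hk; simp [h3 k hk]

theorem stratum5 {K : Type} [Field K] {n : ℕ} (d : Fin 4 → ℕ) (i0 : Fin n)
    (hα : 1 ≤ d 1) :
    ∃ D : MvPolynomial (Par n d) K, D ≠ 0 ∧ ∀ (p : Par n d → K) (u : Fin n → K) (z : K),
      u i0 = 1 → eval u (GG p 1) = 0 → eval u (GG p 2) = 0 →
      (∀ k, k ≠ i0 → eval u (pderiv k (GG p 1)) = -(z ^ 2 * eval u (pderiv k (GG p 2)))) →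
      eval p D = 0 := by
  obtain ⟨D, hD, h⟩ := stratum (K := K) d i0 1 hα {2} (by simp) 1 (by simp)
    (fun β => 0) (-(X (Sum.inr 0) ^ 2 * X (Sum.inl 2)))
  refine ⟨D, hD, fun p u z hu h1 h2 h3 => h p u (fun _ => z) hu ?_ ?_⟩
  · rintro β (rfl | hβ)
    · simp [h1]
    · simp only [Finset.mem_singleton] at hβ
      subst hβ
      simp [h2]
  · intro k hk; simp [h3 k hk]

/-- everything in one chart -/
theorem chart {K : Type} [Field K] {n : ℕ} (d : Fin 4 → ℕ) (i0 : Fin n)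
    (hα : 1 ≤ d 0) (hβ : 1 ≤ d 1) :
    ∃ D : MvPolynomial (Par n d) K, D ≠ 0 ∧ ∀ p : Par n d → K, eval p D ≠ 0 →
      ∀ u : Fin n → K, u i0 = 1 →
      (¬ (eval u (GG p 2) = 0 ∧ ∀ k, k ≠ i0 → eval u (pderiv k (GG p 2)) = 0)) ∧
      (∀ z, ¬ (z * eval u (GG p 2) = 0 ∧ eval u (GG p 1) = 0 ∧ ∀ k, k ≠ i0 →
        eval u (pderiv k (GG p 1)) + z ^ 2 * eval u (pderiv k (GG p 2)) = 0)) ∧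
      (∀ y z, ¬ (z * eval u (GG p 2) = 0 ∧ eval u (GG p 3) + 2 * eval u (GG p 1) * y = 0 ∧
        eval u (GG p 0) + eval u (GG p 1) * y ^ 2 + eval u (GG p 3) * y = 0 ∧ ∀ k, k ≠ i0 →
        eval u (pderiv k (GG p 0)) + y ^ 2 * eval u (pderiv k (GG p 1))
        + y * eval u (pderiv k (GG p 3)) + z ^ 2 * eval u (pderiv k (GG p 2)) = 0)) := by
  obtain ⟨D1, n1, H1⟩ := stratum1' (K := K) d i0 2
  obtain ⟨D2, n2, H2⟩ := stratum2 (K := K) d i0 hα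
  obtain ⟨D3, n3, H3⟩ := stratum1 (K := K) d i0 1 hβ
  obtain ⟨D4, n4, H4⟩ := stratum4 (K := K) d i0 hα
  obtain ⟨D5, n5, H5⟩ := stratum5 (K := K) d i0 hβ
  refine ⟨D1 * D2 * D3 * D4 * D5, by simp [n1, n2, n3, n4, n5], fun p hp u hu => ?_⟩
  simp only [map_mul, ne_eq, mul_eq_zero, not_or] at hp
  obtain ⟨⟨⟨⟨p1, p2⟩, p3⟩, p4⟩, p5⟩ := hp
  refine ⟨fun h => p1 (H1 p u hu h.1 h.2), fun z h => ?_, fun y z h => ?_⟩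
  · obtain ⟨hz, h1, h2⟩ := h
    rcases mul_eq_zero.1 hz with rfl | hc
    · exact p3 (H3 p u hu h1 fun k hk => by linear_combination h2 k hk)
    · exact p5 (H5 p u z hu h1 hc fun k hk => by linear_combination h2 k hk)
  · obtain ⟨hz, h1, h2, h3⟩ := h
    rcases mul_eq_zero.1 hz with rfl | hc
    · exact p2 (H2 p u y hu (by linear_combination h2 - y * h1) (by linear_combination h1)
        fun k hk => by linear_combination h3 k hk)
    · exact p4 (H4 p u y z hu (by linear_combination h2 - y * h1) (by linear_combination h1) hc
        fun k hk => by linear_combination h3 k hk)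

theorem exists_eval_ne {K : Type} [Field K] [Infinite K] {σ : Type} (D : MvPolynomial σ K)
    (h : D ≠ 0) : ∃ p : σ → K, eval p D ≠ 0 := by
  by_contra hc
  push Not at hc
  exact h (MvPolynomial.funext fun x => by simp [hc x])

theorem allcharts {K : Type} [Field K] {n : ℕ} (d : Fin 4 → ℕ)
    (e1 e2 e3 : ℕ) (h01 : d 0 = d 1 + 2 * e1) (h02 : d 0 = d 2 + 2 * e2) (h03 : d 0 = d 3 + e1)
    (h31 : d 3 = d 1 + e1) (h12 : d 1 = d 2 + 2 * e3)
    (hα : 1 ≤ d 0) (hβ : 1 ≤ d 1) (hK : (2 : K) ≠ 0) :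
    ∃ D : MvPolynomial (Par n d) K, D ≠ 0 ∧ ∀ p : Par n d → K, eval p D ≠ 0 →
      ∀ u : Fin n → K, u ≠ 0 → ∀ x y z : K, ¬ (x = 0 ∧ y = 0 ∧ z = 0) → 
      eval u (GG p 0) * x ^ 2 + eval u (GG p 1) * y ^ 2 + eval u (GG p 2) * z ^ 2
        + eval u (GG p 3) * x * y = 0 →
      2 * eval u (GG p 1) * y + eval u (GG p 3) * x = 0 →
      2 * eval u (GG p 2) * z = 0 →
      (∀ k, eval u (pderiv k (GG p 0)) * x ^ 2 + eval u (pderiv k (GG p 1)) * y ^ 2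
        + eval u (pderiv k (GG p 2)) * z ^ 2 + eval u (pderiv k (GG p 3)) * x * y = 0) → False := by
  choose D hD H using fun i0 : Fin n => chart (K := K) d i0 hα hβ
  refine ⟨∏ i, D i, Finset.prod_ne_zero_iff.2 fun i _ => hD i, ?_⟩
  intro p hp u hu x y z hxyz hg hy hz hk
  obtain ⟨i0, hi⟩ : ∃ i, u i ≠ 0 := Function.ne_iff.1 hu
  rw [map_prod, Finset.prod_ne_zero_iff] at hp
  set s := (u i0)⁻¹ with hs
  have hs0 : s ≠ 0 := inv_ne_zero hi
  obtain ⟨P1, P3, P2⟩ := H i0 p (hp i0 (Finset.mem_univ _)) (fun j => s * u j) (inv_mul_cancel₀ hi)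
  have hcz : eval u (GG p 2) * z = 0 := by
    rw [mul_assoc] at hz
    exact (mul_eq_zero.1 hz).resolve_left hK
  have S := fun i => eval_smul_GG p i s u
  have T := fun i k => eval_smul_pderiv_GG p i s u k
  by_cases hx : x = 0
  · subst hx
    by_cases hy0 : y = 0
    · subst hy0
      have hz0 : z ≠ 0 := by simpa using hxyz
      apply P1
      constructor
      · rw [S, (mul_eq_zero.1 hcz).resolve_right hz0, mul_zero]
      · intro k _
        have := hk k
        simp [hz0] at this
        have h2 := T 2 k
        rw [this, mul_zero] at h2
        exact (mul_eq_zero.1 h2).resolve_left hs0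
    · have hb : eval u (GG p 1) = 0 := by simpa [hK, hy0] using hy
      apply P3 (s ^ e3 * z / y)
      refine ⟨?_, ?_, fun k _ => ?_⟩
      · rw [S]
        linear_combination (s ^ e3 / y * s ^ d 2) * hcz
      · rw [S, hb, mul_zero]
      · apply mul_left_cancel₀ hs0
        rw [mul_zero]
        have q1 := T 1 k
        have q2 := T 2 k
        have q := hk k
        rw [h12] at q1
        have : (s ^ e3 * z / y) = s ^ e3 * (z / y) := by ring
        have q' : eval u (pderiv k (GG p 1)) + eval u (pderiv k (GG p 2)) * (z / y) ^ 2 = 0 := by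
          field_simp
          linear_combination q
        rw [this]
        linear_combination q1 + (s ^ e3 * (z / y)) ^ 2 * q2 + s ^ (d 2 + 2 * e3) * q'
  · apply P2 (s ^ e1 * (y / x)) (s ^ e2 * (z / x))
    have w2 : eval u (GG p 3) + 2 * eval u (GG p 1) * (y / x) = 0 := by
      field_simp
      linear_combination hy
    refine ⟨?_, ?_, ?_, fun k _ => ?_⟩
    · rw [S]
      linear_combination (s ^ e2 / x * s ^ d 2) * hcz
    · rw [S, S, h31]
      linear_combination s ^ (d 1 + e1) * w2
    · have w3 : eval u (GG p 0) + eval u (GG p 1) * (y / x) ^ 2 + eval u (GG p 3) * (y / x) = 0 := by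
        field_simp
        linear_combination hg - z * hcz
      have h00 : d 0 = d 1 + e1 + e1 := by omega
      rw [S, S, S, h00, h31]
      linear_combination s ^ (d 1 + e1 + e1) * w3
    · apply mul_left_cancel₀ hs0
      rw [mul_zero]
      have q : eval u (pderiv k (GG p 0)) + eval u (pderiv k (GG p 1)) * (y / x) ^ 2
        + eval u (pderiv k (GG p 2)) * (z / x) ^ 2 + eval u (pderiv k (GG p 3)) * (y / x) = 0 := by
        field_simp
        linear_combination hk k
      have q0 := T 0 k
      have q1 := T 1 k
      have q2 := T 2 k
      have q3 := T 3 k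
      have r1 : s ^ d 1 * (s ^ e1) ^ 2 = s ^ d 0 := by rw [h01]; ring
      have r2 : s ^ d 2 * (s ^ e2) ^ 2 = s ^ d 0 := by rw [h02]; ring
      have r3 : s ^ d 3 * s ^ e1 = s ^ d 0 := by rw [h03]; ring
      linear_combination q0 + (s ^ e1 * (y / x)) ^ 2 * q1 + (s ^ e1 * (y / x)) * q3 +
        (s ^ e2 * (z / x)) ^ 2 * q2 + s ^ d 0 * q + (y / x) ^ 2 * eval u (pderiv k (GG p 1)) * r1
        + (z / x) ^ 2 * eval u (pderiv k (GG p 2)) * r2 + (y / x) * eval u (pderiv k (GG p 3)) * r3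

theorem GG_of_homog (K : Type) [Field K] {n : ℕ} (d : Fin 4 → ℕ)
    (abcf : Fin 4 → MvPolynomial (Fin n) K) (h : ∀ i, IsHomogZ K n (d i : ℤ) (abcf i)) (i : Fin 4) :
    GG (fun s : Par n d => (abcf s.1).coeff s.2.1) i = abcf i := by
  ext e
  by_cases he : ∑ j, e j = d i
  · exact GG_coeff _ (⟨i, e, by simp [Finset.mem_finsuppAntidiag, he]⟩ : Par n d)
  · rw [GG_coeff_zero _ _ _ he]
    by_contra hc
    have := h i e (mem_support_iff.2 (Ne.symm hc))
    exact he (by exact_mod_cast this)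

theorem GG_homog (K : Type) [Field K] {n : ℕ} (d : Fin 4 → ℕ) (p : Par n d → K) (i : Fin 4) :
    IsHomogZ K n (d i : ℤ) (GG p i) := by
  intro e he
  by_contra hc
  refine mem_support_iff.1 he (GG_coeff_zero p i e fun h => hc ?_)
  exact_mod_cast h

theorem pderiv_inr_rename {K : Type} [Field K] {n m : ℕ} (j : Fin m) (q : MvPolynomial (Fin n) K) :
    pderiv (Sum.inr j : Fin n ⊕ Fin m) (rename Sum.inl q) = 0 := by
  classical
  apply pderiv_eq_zero_of_notMem_vars
  intro h
  have := vars_rename _ _ h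
  simp at this

theorem core (K : Type) [Field K] [CharZero K] (n : ℕ) (d : Fin 4 → ℕ)
    (e1 e2 e3 : ℕ) (h01 : d 0 = d 1 + 2 * e1) (h02 : d 0 = d 2 + 2 * e2) (h03 : d 0 = d 3 + e1)
    (h31 : d 3 = d 1 + e1) (h12 : d 1 = d 2 + 2 * e3)
    (hα : 1 ≤ d 0) (hβ : 1 ≤ d 1) :
    GenerallyHolds4 K n (fun i => (d i : ℤ))
      (fun abcf => IsSmoothModel K (specialMemberX K abcf)) := by
  obtain ⟨D, hD, H⟩ := allcharts (K := K) (n := n) d e1 e2 e3 h01 h02 h03 h31 h12 hα hβ two_ne_zero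
  have hev : ∀ abcf : Fin 4 → MvPolynomial (Fin n) K,
      evalCoeff4 K abcf (rename (fun s : Par n d => (s.1, s.2.1)) D) =
        eval (fun s : Par n d => (abcf s.1).coeff s.2.1) D := by
    intro abcf
    rw [evalCoeff4, eval_rename]
    rfl
  refine ⟨rename (fun s : Par n d => (s.1, s.2.1)) D, ?_, ?_⟩
  · obtain ⟨p, hp⟩ := exists_eval_ne D hD
    refine ⟨fun i => GG p i, GG_homog K d p, ?_⟩
    rw [hev]
    simpa only [GG_coeff] using hp
  · intro abcf hh hne
    rw [hev] at hne
    have hG := GG_of_homog K d abcf hh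
    rintro ⟨u, x⟩ ⟨hu, hx⟩ hg
    by_contra hc
    push Not at hc
    have key := H _ hne u hu (x 0) (x 1) (x 2) ?_ ?_ ?_ ?_ ?_
    · exact key
    · rintro ⟨a0, a1, a2⟩
      apply hx
      funext j
      fin_cases j
      · exact a0
      · exact a1
      · exact a2
    · simp only [hG]
      simpa [specialMemberX, evalPt, eval_rename, Function.comp_def] using hg
    · simp only [hG]
      have := hc (Sum.inr 1)
      simp [specialMemberX, evalPt, eval_rename, Function.comp_def, pderiv_inr_rename, pderiv_mul,
        pderiv_pow, pderiv_X, Pi.single_apply] at this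
      linear_combination this
    · simp only [hG]
      have := hc (Sum.inr 2)
      simp [specialMemberX, evalPt, eval_rename, Function.comp_def, pderiv_inr_rename, pderiv_mul,
        pderiv_pow, pderiv_X, Pi.single_apply] at this
      rw [mul_assoc, mul_eq_zero, mul_eq_zero]
      tauto
    · intro k
      simp only [hG]
      have := hc (Sum.inl k)
      simp [specialMemberX, evalPt, eval_rename, Function.comp_def, pderiv_mul,
        pderiv_rename Sum.inl_injective, pderiv_pow, pderiv_X, Pi.single_apply] at this
      linear_combination this

/-- **Lemma 3.2.**  Over an algebraically closed field of characteristic 0, the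
special member `X = {a x² + b y² + c z² + f x y = 0} ⊂ P_n(λ,μ,ν)` with `a,b,c,f`
general of degrees `-λ+μ+ν, λ-μ+ν, λ+μ-ν, ν` is smooth. -/
theorem lem_special_member_smooth_char_zero
    (K : Type) [Field K] [IsAlgClosed K] [CharZero K]
    (n : ℕ) (hn : 3 ≤ n) (lam mu nu : ℤ)
    (h0 : 0 < lam) (h1 : lam ≤ mu) (h2 : mu ≤ nu) (h3 : nu ≤ lam + mu)
    (h4 : 3 ≤ nu) :
    GenerallyHolds4 K n ![-lam + mu + nu, lam - mu + nu, lam + mu - nu, nu]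
      (fun abcf => IsSmoothModel K (specialMemberX K abcf)) := by
  lift lam to ℕ using h0.le
  lift mu to ℕ using by omega
  lift nu to ℕ using by omega
  have key := core K n ![mu + nu - lam, lam + nu - mu, lam + mu - nu, nu] (mu - lam) (nu - lam)
    (nu - mu) (by simp; omega) (by simp; omega) (by simp; omega) (by simp; omega) (by simp; omega)
    (by simp; omega) (by simp; omega)
  convert key using 1
  funext i
  fin_cases i <;> simp <;> omega

end ConicBundleFormalization
end

section
/- Let n ≥ 3 and let λ, μ, ν be integers with 0 < λ ≤ μ ≤ ν ≤ λ + μ and ν ≥ 3. Over an algebraically closed field 𝕜 of characteristic 2, let a, b, c, f ∈ 𝕜[u_0,…,u_{n−1}] be general homogeneous polynomials of degrees −λ+μ+ν, λ−μ+ν, λ+μ−ν, ν respectively, let R be the ℙ(1,1,2)-bundle over ℙ^{n−1} with Cox coordinates u_0,…,u_{n−1} of bidegree (1,0) and x, y, z̄ of bidegrees (λ,1), (μ,1), (2ν,2), and let Z ⊂ R be the hypersurface a x² + b y² + c z̄ + f x y = 0. Set Ξ_Z = Z ∩ (x = y = 0) and Z° = Z ∖ Ξ_Z. Then Z° is smooth.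 -/
/-!
Formalization framework for "Stable rationality of higher dimensional conic bundles"
(Ahmadinezhad–Okada).

We model a weighted-projective-space bundle `P` over `ℙ^{n-1}` (in particular the
`ℙ²`-bundle `P_n(k,l,m) = ℙ(𝒪(-k) ⊕ 𝒪(-l) ⊕ 𝒪(-m))`, and the `ℙ(1,1,2)`-bundle `R`)
through its Cox ring `K[u_0,…,u_{n-1}, x_0,…,x_{m-1}]`, bigraded by
`deg u_i = (1,0)`, `deg x_j = (w j, a j)`, together with the action of the
two-dimensional torus on the affine cone.  A member `X` of the complete linear
system `|𝒪_P(α,β)| = |α F + β D|` (`F` the pullback of the hyperplane class of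
`ℙ^{n-1}`, `D` the tautological class) is recorded by a bihomogeneous polynomial
`g` of bidegree `(α,β)`, and the projection `π : X → ℙ^{n-1}` is induced by the
coordinates `u_0,…,u_{n-1}`.

Geometric notions are rendered as follows (all are genuine definitions):

* a *general* (resp. *very general*) member of a linear system: the property holds
  on a nonempty principal Zariski-open subset of the parameter space (resp. away
  from countably many proper closed subsets);
* smoothness of `X`: the Jacobian criterion on the punctured affine cone (where the
  torus acts freely the quotient map is a torsor, so this is smoothness of `X`);
* the function field `K(X)`: the degree-`(0,0)` part of the fraction field of the
  homogeneous coordinate ring `Cox/(g)`, i.e. the subalgebra generated by ratios of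
  bihomogeneous elements of equal bidegree;
* rationality: `K(X)` is `K`-isomorphic to a purely transcendental extension of
  `K` (i.e. `X` is birational to a projective space);
* stable rationality: `K(X)(x_1,…,x_r) ≅_K K(y_1,…,y_s)` for some `r,s`
  (i.e. `X × ℙ^r` is birational to a projective space);
* normality: the local rings of the relevant locus of the affine cone are
  integrally closed (the punctured cone is a smooth torsor over `X`);
* terminal singularities: rendered as `X` normal with singular locus of
  codimension at least 3, which is the form terminality takes for the general
  members appearing in the paper;
* ℚ-factoriality together with `ρ(X) = 2` (i.e. the divisor class group of `X` is
  spanned up to torsion by the fibre class `F` and the tautological class `D`):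
  rendered by requiring every relevant bihomogeneous height-one prime `P` of the
  coordinate ring of `X` to contain a bihomogeneous element lying in no other such
  prime (so that `div(f) = k·P` and `[P] ∈ ℚ⟨F, D⟩`);
* ampleness of `𝒪_X(α,β)`: some multiple is very ample, rendered by requiring the
  bihomogeneous sections of that multiple to be base point free, to separate
  points, and to separate tangent vectors (modulo the torus directions) on the
  cone over `X`;
* `π`-ampleness of `-K_X`: by adjunction `-K_X = 𝒪_X(e,1)` with
  `e = n + Σ w - deg g`, and relative ampleness over the projective base means
  some twist `𝒪_X(e+N,1)` by pullback classes from `ℙ^{n-1}` is ample;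
* connectedness of the fibres of `π : X → ℙ^{n-1}`: no fibre admits a disjoint
  covering by two zero sets of families of weighted-homogeneous polynomials, each
  meeting the fibre (i.e. Zariski-connectedness of the fibres), and all fibres are
  nonempty;
* a conic bundle (Mori fibre space of relative dimension one, Definition 2.5 of
  the paper): `X` is irreducible (the ideal of `g` is prime), normal, has only
  terminal singularities, `π` has connected fibres, `-K_X` is `π`-ample, and
  `ρ(X) = 2`; all in the above renderings.
-/

open MvPolynomial

set_option maxHeartbeats 1600000
set_option synthInstance.maxHeartbeats 400000

namespace ConicBundleFormalization

open MvPolynomial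

section Aux

variable {K : Type} [Field K]

theorem tri_dep {I σ S : Type} [Finite I] [Fintype σ] [Fintype S]
    (ι : S → I) (hι : Function.Injective ι) (hc : Fintype.card σ < Fintype.card S)
    (G : S → MvPolynomial (I ⊕ σ) K) :
    ∃ D : MvPolynomial I K, D ≠ 0 ∧ ∀ (b b0 : I → K) (t : σ → K),
      (∀ i, i ∉ Set.range ι → b0 i = b i) → (∀ s, b0 (ι s) = 0) →
      (∀ s, b (ι s) = eval (Sum.elim b0 t) (G s)) → eval b D = 0 := by
  classical
  have := Fintype.ofFinite I
  let J := {i : I // i ∉ Set.range ι}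
  let sub : I ⊕ σ → MvPolynomial (J ⊕ σ) K :=
    Sum.elim (fun i => if h : i ∉ Set.range ι then X (Sum.inl ⟨i, h⟩) else 0)
      (fun s => X (Sum.inr s))
  let Φ : I → MvPolynomial (J ⊕ σ) K := fun i =>
    if h : i ∈ Set.range ι then aeval sub (G h.choose) else X (Sum.inl ⟨i, h⟩)
  have hna : ¬ AlgebraicIndependent K Φ := by
    intro h
    have h1 := h.cardinalMk_le_trdeg
    rw [MvPolynomial.trdeg_of_isDomain] at h1
    simp only [Cardinal.mk_fintype, Cardinal.lift_natCast, Nat.cast_le, Fintype.card_sum] at h1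
    have h2 : Fintype.card J = Fintype.card I - Fintype.card S := by
      have e1 := Fintype.card_subtype_compl (fun i => i ∈ Set.range ι)
      have e2 : Fintype.card {i // i ∈ Set.range ι} = Fintype.card S :=
        Set.card_range_of_injective hι
      rw [e2] at e1
      rw [← e1]
    have h3 := Fintype.card_le_of_injective ι hι
    omega
  rw [algebraicIndependent_iff] at hna
  push Not at hna
  obtain ⟨D, hD, hD0⟩ := hna
  refine ⟨D, hD0, fun b b0 t hb0 hb1 hb => ?_⟩
  let ev : MvPolynomial (J ⊕ σ) K →ₐ[K] K := aeval (Sum.elim (fun j : J => b j.1) t)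
  have key : ∀ i, ev (Φ i) = b i := by
    intro i
    by_cases h : i ∈ Set.range ι
    · have hs := h.choose_spec
      simp only [Φ, dif_pos h]
      conv_rhs => rw [← hs, hb]
      rw [← AlgHom.comp_apply, comp_aeval, ← coe_aeval_eq_eval]
      change _ = aeval (Sum.elim b0 t) _
      congr 2
      funext x
      rcases x with i | s
      · by_cases hi : i ∈ Set.range ι
        · obtain ⟨s, rfl⟩ := hi
          have hn : ¬ (ι s ∉ Set.range ι) := fun h => h ⟨s, rfl⟩
          simp only [sub, Sum.elim_inl, dif_neg hn, hb1, map_zero]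
        · simp only [sub, Sum.elim_inl, dif_pos (show i ∉ Set.range ι from hi), hb0 i hi]
          simp [ev]
      · simp [sub, ev]
    · simp only [Φ, dif_neg h]
      simp [ev]
  have := congrArg ev hD
  rw [← AlgHom.comp_apply, comp_aeval, map_zero] at this
  simp only [key] at this
  simpa [coe_aeval_eq_eval] using this

/-- indices of coefficients -/
abbrev Idx {n : ℕ} (d : Fin 4 → ℕ) : Type :=
  {q : Fin 4 × (Fin n →₀ ℕ) // q.2.degree = d q.1}

instance {n : ℕ} (d : Fin 4 → ℕ) : Finite (Idx (n := n) d) := by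
  have : Set.Finite {q : Fin 4 × (Fin n →₀ ℕ) | q.2.degree = d q.1} := by
    refine Set.Finite.subset (Set.Finite.prod (Set.finite_univ (α := Fin 4))
      (Finsupp.finite_of_degree_le (σ := Fin n) (∑ k, d k))) ?_
    intro q hq
    refine ⟨trivial, ?_⟩
    simp only [Set.mem_ofPred_eq] at hq ⊢
    rw [hq]
    exact Finset.single_le_sum (f := d) (fun _ _ => Nat.zero_le _) (Finset.mem_univ q.1)
  exact this

open Classical in
/-- generic polynomial -/
noncomputable def gpol {n : ℕ} {d : Fin 4 → ℕ} {R : Type} [CommRing R] (c : Idx (n := n) d → R)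
    (k : Fin 4) : MvPolynomial (Fin n) R :=
  ∑ e ∈ Finset.univ.finsuppAntidiag (d k),
    if h : e.degree = d k then monomial e (c ⟨(k, e), h⟩) else 0

theorem coeff_gpol {n : ℕ} {d : Fin 4 → ℕ} {R : Type} [CommRing R] (c : Idx (n := n) d → R)
    (k : Fin 4) (e : Fin n →₀ ℕ) :
    coeff e (gpol c k) = if h : e.degree = d k then c ⟨(k, e), h⟩ else 0 := by
  classical
  unfold gpol
  rw [coeff_sum]
  rw [Finset.sum_eq_single e]
  · split_ifs <;> simp
  · intro e' _ hne
    split_ifs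
    · rw [coeff_monomial, if_neg hne]
    · simp
  · intro he
    have : ¬ e.degree = d k := by
      intro h
      apply he
      simp [← h, Finsupp.degree_eq_sum]
    rw [dif_neg this]; simp

theorem map_gpol {n : ℕ} {d : Fin 4 → ℕ} {R T : Type} [CommRing R] [CommRing T] (φ : R →+* T)
    (c : Idx (n := n) d → R) (k : Fin 4) :
    MvPolynomial.map φ (gpol c k) = gpol (fun i => φ (c i)) k := by
  ext e
  rw [coeff_map, coeff_gpol, coeff_gpol]
  split_ifs <;> simp

theorem gpol_split {n : ℕ} {d : Fin 4 → ℕ} {S : Type} [Fintype S]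
    (ι : S → Idx (n := n) d) (hι : Function.Injective ι) (b b0 : Idx (n := n) d → K)
    (hb0 : ∀ i, i ∉ Set.range ι → b0 i = b i) (hb1 : ∀ s, b0 (ι s) = 0) (k : Fin 4) :
    gpol b k = gpol b0 k +
      ∑ s, if (ι s).1.1 = k then monomial (ι s).1.2 (b (ι s)) else 0 := by
  classical
  ext e
  rw [coeff_add, coeff_gpol, coeff_gpol, coeff_sum]
  by_cases h : e.degree = d k
  · rw [dif_pos h, dif_pos h]
    have hs : ∀ s, coeff e (if (ι s).1.1 = k then monomial (ι s).1.2 (b (ι s)) else 0)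
        = if ι s = ⟨(k, e), h⟩ then b (ι s) else 0 := by
      intro s
      by_cases h1 : (ι s).1.1 = k
      · rw [if_pos h1, coeff_monomial]
        congr 1
        rw [Subtype.ext_iff, Prod.ext_iff]
        simp [h1]
      · rw [if_neg h1, if_neg, coeff_zero]
        intro h2
        rw [h2] at h1
        exact h1 rfl
    simp only [hs]
    by_cases hr : (⟨(k, e), h⟩ : Idx (n := n) d) ∈ Set.range ι
    · obtain ⟨s, hs'⟩ := hr
      rw [← hs', hb1, zero_add, Finset.sum_eq_single s]
      · simp
      · intro s' _ hne
        rw [if_neg]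
        exact fun hh => hne (hι hh)
      · simp
    · rw [hb0 _ hr, Finset.sum_eq_zero, add_zero]
      intro s _
      rw [if_neg]
      exact fun hh => hr ⟨s, hh⟩
  · rw [dif_neg h, dif_neg h, zero_add, Finset.sum_eq_zero]
    intro s _
    by_cases h1 : (ι s).1.1 = k
    · rw [if_pos h1, coeff_monomial, if_neg]
      intro h2
      apply h
      rw [← h2, (ι s).2, h1]
    · rw [if_neg h1, coeff_zero]


theorem eval_mono_smul {n : ℕ} (s r : K) (u : Fin n → K) (e : Fin n →₀ ℕ) :
    eval (s • u) (monomial e r) = s ^ e.degree * eval u (monomial e r) := by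
  rw [eval_monomial, eval_monomial, Finsupp.degree_eq_sum, ← Finset.prod_pow_eq_pow_sum]
  rw [Finsupp.prod_fintype _ _ (by simp), Finsupp.prod_fintype _ _ (by simp)]
  simp only [Pi.smul_apply, smul_eq_mul, mul_pow, Finset.prod_mul_distrib]
  ring

theorem eval_gpol_smul {n : ℕ} {d : Fin 4 → ℕ} (b : Idx (n := n) d → K) (k : Fin 4)
    (s : K) (u : Fin n → K) :
    eval (s • u) (gpol b k) = s ^ d k * eval u (gpol b k) := by
  unfold gpol
  rw [map_sum, map_sum, Finset.mul_sum]
  refine Finset.sum_congr rfl fun e _ => ?_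
  split_ifs with h
  · rw [eval_mono_smul, h]
  · simp

theorem eval_pderiv_gpol_smul {n : ℕ} {d : Fin 4 → ℕ} (b : Idx (n := n) d → K) (k : Fin 4)
    (s : K) (u : Fin n → K) (j : Fin n) :
    s * eval (s • u) (pderiv j (gpol b k)) = s ^ d k * eval u (pderiv j (gpol b k)) := by
  unfold gpol
  rw [map_sum, map_sum, map_sum, Finset.mul_sum, Finset.mul_sum]
  refine Finset.sum_congr rfl fun e _ => ?_
  split_ifs with h
  · rw [pderiv_monomial, eval_mono_smul]
    by_cases he : e j = 0
    · simp [he]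
    · have h1 : (e - Finsupp.single j 1).degree + 1 = d k := by
        rw [← h]
        have : e - Finsupp.single j 1 + Finsupp.single j 1 = e :=
          tsub_add_cancel_of_le (by simpa using Nat.one_le_iff_ne_zero.mpr he)
        conv_rhs => rw [← this]
        simp
      rw [← h1, pow_succ]
      ring
  · simp

/-- special coefficient indices -/
noncomputable def spec {n : ℕ} (d : Fin 4 → ℕ) (i0 : Fin n) (k0 : Fin 4) (hd : 1 ≤ d k0) :
    {j : Fin n // j ≠ i0} ⊕ Fin 3 → Idx (n := n) d :=
  Sum.elim (fun j => ⟨(k0, Finsupp.single i0 (d k0 - 1) + Finsupp.single j.1 1), by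
      rw [map_add, Finsupp.degree_single, Finsupp.degree_single]; exact Nat.sub_add_cancel hd⟩)
    ![⟨(k0, Finsupp.single i0 (d k0)), by simp⟩,
      ⟨(2, Finsupp.single i0 (d 2)), by simp⟩,
      ⟨(3, Finsupp.single i0 (d 3)), by simp⟩]

theorem spec_inj {n : ℕ} (d : Fin 4 → ℕ) (i0 : Fin n) (k0 : Fin 4) (hd : 1 ≤ d k0)
    (h2 : k0 ≠ 2) (h3 : k0 ≠ 3) : Function.Injective (spec d i0 k0 hd) := by
  have key : ∀ (j : {j : Fin n // j ≠ i0}) (s : Fin 3),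
      spec d i0 k0 hd (Sum.inl j) ≠ spec d i0 k0 hd (Sum.inr s) := by
    intro j s h
    have h' := congrArg (fun q : Idx (n := n) d => q.1.2 j.1) h
    have hj : i0 ≠ j.1 := fun h => j.2 h.symm
    fin_cases s <;> simp [spec, hj] at h'
  rintro (j | s) (j' | s') h
  · have h' := congrArg (fun q : Idx (n := n) d => q.1.2 j.1) h
    have hj : i0 ≠ j.1 := fun h => j.2 h.symm
    simp only [spec, Sum.elim_inl, Finsupp.add_apply, Finsupp.single_apply, if_neg hj] at h'
    simp only [if_true, zero_add] at h'
    by_cases hh : j'.1 = j.1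
    · rw [Subtype.ext hh]
    · simp [hh] at h'
  · exact absurd h (key _ _)
  · exact absurd h.symm (key _ _)
  · have h' := congrArg (fun q : Idx (n := n) d => q.1.1) h
    have a2 : (2 : Fin 4) ≠ k0 := h2.symm
    have a3 : (3 : Fin 4) ≠ k0 := h3.symm
    clear h key
    fin_cases s <;> fin_cases s' <;> first | rfl | (exfalso; revert h'; simp [spec, h2, h3, a2, a3])

theorem hom_eval {n : ℕ} {R : Type} [CommRing R] (φ : R →+* K) (U : Fin n → R)
    (P : MvPolynomial (Fin n) R) :
    φ (eval U P) = eval (fun i => φ (U i)) (MvPolynomial.map φ P) := by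
  have : φ.comp (eval U) = (eval (fun i => φ (U i))).comp (MvPolynomial.map φ) := by
    apply MvPolynomial.ringHom_ext <;> intro <;> simp
  exact RingHom.congr_fun this P

theorem ev_mono0 {n : ℕ} (u : Fin n → K) (i0 : Fin n) (hu : u i0 = 1) (m : ℕ) (r : K) :
    eval u (monomial (Finsupp.single i0 m) r) = r := by
  simp [eval_monomial, hu]

theorem ev_dmono0 {n : ℕ} (u : Fin n → K) (i0 : Fin n) (m : ℕ) (r : K)
    (j : Fin n) (hj : j ≠ i0) :
    eval u (pderiv j (monomial (Finsupp.single i0 m) r)) = 0 := by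
  rw [pderiv_monomial, Finsupp.single_eq_of_ne hj]
  simp

theorem ev_mono1 {n : ℕ} (u : Fin n → K) (i0 : Fin n) (hu : u i0 = 1) (m : ℕ) (r : K)
    (j : Fin n) :
    eval u (monomial (Finsupp.single i0 m + Finsupp.single j 1) r) = r * u j := by
  have : monomial (Finsupp.single i0 m + Finsupp.single j 1) r
      = monomial (Finsupp.single i0 m) r * X j := by
    rw [X, monomial_mul, mul_one]
  rw [this, map_mul, ev_mono0 u i0 hu, eval_X]

theorem ev_dmono1 {n : ℕ} (u : Fin n → K) (i0 : Fin n) (hu : u i0 = 1) (m : ℕ) (r : K)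
    (j l : Fin n) (hl : l ≠ i0) :
    eval u (pderiv l (monomial (Finsupp.single i0 m + Finsupp.single j 1) r))
      = if j = l then r else 0 := by
  have : monomial (Finsupp.single i0 m + Finsupp.single j 1) r
      = monomial (Finsupp.single i0 m) r * X j := by
    rw [X, monomial_mul, mul_one]
  rw [this, pderiv_mul, map_add, map_mul, map_mul, ev_mono0 u i0 hu, ev_dmono0 u i0 m r l hl]
  by_cases h : j = l
  · subst h; simp
  · rw [pderiv_X_of_ne h, if_neg h]; simp

theorem chart_s14 {n : ℕ} (d : Fin 4 → ℕ) (i0 : Fin n) (k0 k1 : Fin 4) (hd : 1 ≤ d k0)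
    (h2 : k0 ≠ 2) (h3 : k0 ≠ 3) (h2' : k1 ≠ 2) (h3' : k1 ≠ 3) (h01 : k0 ≠ k1) :
    ∃ D : MvPolynomial (Idx (n := n) d) K, D ≠ 0 ∧
      ∀ (b : Idx (n := n) d → K) (u : Fin n → K) (y z : K), u i0 = 1 →
        eval u (gpol b 2) = 0 → eval u (gpol b 3) = 0 →
        eval u (gpol b k0) + eval u (gpol b k1) * y ^ 2 = 0 →
        (∀ j, j ≠ i0 → eval u (pderiv j (gpol b k0)) + eval u (pderiv j (gpol b k1)) * y ^ 2
          + eval u (pderiv j (gpol b 2)) * z + eval u (pderiv j (gpol b 3)) * y = 0) →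
        eval b D = 0 := by
  classical
  let T := {j : Fin n // j ≠ i0}
  let R := MvPolynomial (Idx (n := n) d ⊕ (T ⊕ Fin 2)) K
  let c : Idx (n := n) d → R := fun i => X (Sum.inl i)
  let U : Fin n → R := fun j => if h : j ≠ i0 then X (Sum.inr (Sum.inl ⟨j, h⟩)) else 1
  let Y : R := X (Sum.inr (Sum.inr 0))
  let Z : R := X (Sum.inr (Sum.inr 1))
  let G1 : T → R := fun j =>
    -(eval U (pderiv j.1 (gpol c k0)) + eval U (pderiv j.1 (gpol c k1)) * Y ^ 2
          + eval U (pderiv j.1 (gpol c 2)) * Z + eval U (pderiv j.1 (gpol c 3)) * Y)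
  let G : T ⊕ Fin 3 → R := Sum.elim G1
    ![-(eval U (gpol c k0) + (∑ j : T, G1 j * U j.1) + eval U (gpol c k1) * Y ^ 2),
      -(eval U (gpol c 2)), -(eval U (gpol c 3))]
  have hι := spec_inj d i0 k0 hd h2 h3
  obtain ⟨D, hD0, hD⟩ := tri_dep (K := K) (σ := T ⊕ Fin 2) (spec d i0 k0 hd) hι
    (by rw [Fintype.card_sum, Fintype.card_sum]; exact Nat.add_lt_add_left (by simp) _) G
  refine ⟨D, hD0, fun b u y z hu hc hf ha hder => ?_⟩
  let b0 : Idx (n := n) d → K := fun i => if i ∈ Set.range (spec d i0 k0 hd) then 0 else b i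
  have hb0 : ∀ i, i ∉ Set.range (spec d i0 k0 hd) → b0 i = b i := fun i hi => if_neg hi
  have hb1 : ∀ s, b0 (spec d i0 k0 hd s) = 0 := fun s => if_pos ⟨s, rfl⟩
  have hsplit := gpol_split (spec d i0 k0 hd) hι b b0 hb0 hb1
  have e0 := hsplit k0
  have e1 := hsplit k1
  have e2 := hsplit 2
  have e3 := hsplit 3
  have p1 : ∀ j : T, (spec d i0 k0 hd (Sum.inl j)).1 =
    (k0, Finsupp.single i0 (d k0 - 1) + Finsupp.single j.1 1) := fun j => rfl
  have q0 : (spec d i0 k0 hd (Sum.inr 0)).1 = (k0, Finsupp.single i0 (d k0)) := rfl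
  have q1 : (spec d i0 k0 hd (Sum.inr 1)).1 = (2, Finsupp.single i0 (d 2)) := rfl
  have q2 : (spec d i0 k0 hd (Sum.inr 2)).1 = (3, Finsupp.single i0 (d 3)) := rfl
  simp only [Fintype.sum_sum_type, Fin.sum_univ_three, p1, q0, q1, q2, h2, h3, h01, h2.symm,
    h3.symm, h2'.symm, h3'.symm, if_true, if_false, Finset.sum_const_zero, add_zero, zero_add,
    show ¬ ((2 : Fin 4) = 3) by decide, show ¬ ((3 : Fin 4) = 2) by decide] at e0 e1 e2 e3
  let t : T ⊕ Fin 2 → K := Sum.elim (fun j => u j.1) ![y, z]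
  let φ : R →+* K := eval (Sum.elim b0 t)
  have hU : (fun i => φ (U i)) = u := by
    funext i
    by_cases h : i ≠ i0
    · simp only [U, dif_pos h]
      exact eval_X _
    · simp only [U, dif_neg h, map_one]
      rw [not_not.mp h, hu]
  have hc' : (fun i => φ (c i)) = b0 := by
    funext i
    exact eval_X _
  have hY : φ Y = y := eval_X _
  have hZ : φ Z = z := eval_X _
  have hev : ∀ k, φ (eval U (gpol c k)) = eval u (gpol b0 k) := by
    intro k
    rw [hom_eval, map_gpol, hU, hc']
  have hdev : ∀ k j, φ (eval U (pderiv j (gpol c k))) = eval u (pderiv j (gpol b0 k)) := by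
    intro k j
    rw [hom_eval, ← pderiv_map, map_gpol, hU, hc']
  have hG1 : ∀ j : T, φ (G1 j) = b (spec d i0 k0 hd (Sum.inl j)) := by
    intro j
    have hj := hder j.1 j.2
    rw [e0, e1, e2, e3] at hj
    simp only [map_add, map_sum, ev_dmono0 u i0 _ _ _ j.2, ev_dmono1 u i0 hu _ _ _ _ j.2,
      add_zero] at hj
    have hsum : (∑ x : T, if x.1 = j.1 then b (spec d i0 k0 hd (Sum.inl x)) else 0)
        = b (spec d i0 k0 hd (Sum.inl j)) := by
      rw [Finset.sum_eq_single j]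
      · simp
      · intro x _ hx
        rw [if_neg]
        exact fun h => hx (Subtype.ext h)
      · simp
    rw [hsum] at hj
    simp only [G1, map_neg, map_add, map_mul, map_pow, hY, hZ, hdev]
    linear_combination -hj
  refine hD b b0 t hb0 hb1 ?_
  have hUj : ∀ j, φ (U j) = u j := fun j => congrFun hU j
  rintro (j | s)
  · exact (hG1 j).symm
  · fin_cases s
    · change b (spec d i0 k0 hd (Sum.inr 0)) =
        φ (-(eval U (gpol c k0) + (∑ j : T, G1 j * U j.1) + eval U (gpol c k1) * Y ^ 2))
      simp only [map_neg, map_add, map_mul, map_pow, map_sum, hY, hev, hG1, hUj]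
      rw [e0, e1] at ha
      simp only [map_add, map_sum, ev_mono0 u i0 hu, ev_mono1 u i0 hu] at ha
      linear_combination ha
    · change b (spec d i0 k0 hd (Sum.inr 1)) = φ (-(eval U (gpol c 2)))
      rw [e2, map_add, ev_mono0 u i0 hu] at hc
      rw [map_neg, hev]
      linear_combination hc
    · change b (spec d i0 k0 hd (Sum.inr 2)) = φ (-(eval U (gpol c 3)))
      rw [e3, map_add, ev_mono0 u i0 hu] at hf
      rw [map_neg, hev]
      linear_combination hf

theorem chart_scaled {n : ℕ} (d : Fin 4 → ℕ) (i0 : Fin n) (k0 k1 : Fin 4) (hd : 1 ≤ d k0)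
    (h2 : k0 ≠ 2) (h3 : k0 ≠ 3) (h2' : k1 ≠ 2) (h3' : k1 ≠ 3) (h01 : k0 ≠ k1)
    (hdd : d k0 + d k1 = 2 * d 3) :
    ∃ D : MvPolynomial (Idx (n := n) d) K, D ≠ 0 ∧
      ∀ (b : Idx (n := n) d → K) (u : Fin n → K) (x y z : K), u i0 ≠ 0 → x ≠ 0 →
        eval u (gpol b 2) = 0 → eval u (gpol b 3) = 0 →
        eval u (gpol b k0) * x ^ 2 + eval u (gpol b k1) * y ^ 2 = 0 →
        (∀ j, eval u (pderiv j (gpol b k0)) * x ^ 2 + eval u (pderiv j (gpol b k1)) * y ^ 2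
          + eval u (pderiv j (gpol b 2)) * z + eval u (pderiv j (gpol b 3)) * x * y = 0) →
        eval b D = 0 := by
  obtain ⟨D, hD0, hD⟩ := chart_s14 (K := K) d i0 k0 k1 hd h2 h3 h2' h3' h01
  refine ⟨D, hD0, fun b u x y z hu hx hc hf ha hder => ?_⟩
  obtain ⟨s, hs⟩ : ∃ s, s = u i0 := ⟨_, rfl⟩
  have hs0 : s ≠ 0 := hs ▸ hu
  obtain ⟨v, hv⟩ : ∃ v, v = s⁻¹ • u := ⟨_, rfl⟩
  have huv : u = s • v := by rw [hv, smul_smul, mul_inv_cancel₀ hs0, one_smul]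
  have hp : ∀ m : ℕ, s ^ m ≠ 0 := fun m => pow_ne_zero m hs0
  have hpow : s ^ d k0 * s ^ d k1 = (s ^ d 3) ^ 2 := by
    rw [← pow_add, hdd, mul_comm, pow_mul]
  have hvi : v i0 = 1 := by
    rw [hv, hs]; simp [hu]
  have ev : ∀ k, eval u (gpol b k) = s ^ d k * eval v (gpol b k) := by
    intro k; rw [huv, eval_gpol_smul]
  have dev : ∀ k j, s * eval u (pderiv j (gpol b k)) = s ^ d k * eval v (pderiv j (gpol b k)) := by
    intro k j; rw [huv, eval_pderiv_gpol_smul]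
  refine hD b v (s ^ d 3 * y / (s ^ d k0 * x)) (s ^ d 2 * z / (s ^ d k0 * x ^ 2)) hvi ?_ ?_ ?_ ?_
  · have := ev 2
    rw [hc] at this
    exact (mul_eq_zero.mp this.symm).resolve_left (hp _)
  · have := ev 3
    rw [hf] at this
    exact (mul_eq_zero.mp this.symm).resolve_left (hp _)
  · rw [ev, ev] at ha
    have e : (s ^ d 3 * y / (s ^ d k0 * x)) ^ 2 = s ^ d k1 * y ^ 2 / (s ^ d k0 * x ^ 2) := by
      rw [div_pow, mul_pow, ← hpow, div_eq_div_iff (by positivity) (by positivity)]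
      ring
    rw [e]
    have h0 := hp (d k0)
    field_simp
    linear_combination ha
  · intro j _
    have e : (s ^ d 3 * y / (s ^ d k0 * x)) ^ 2 = s ^ d k1 * y ^ 2 / (s ^ d k0 * x ^ 2) := by
      rw [div_pow, mul_pow, ← hpow, div_eq_div_iff (by positivity) (by positivity)]
      ring
    rw [e]
    have h0 := hp (d k0)
    field_simp
    linear_combination s * hder j - x ^ 2 * dev k0 j - y ^ 2 * dev k1 j - z * dev 2 j
      - x * y * dev 3 j

end Aux

theorem homog_eq_gpol {K : Type} [Field K] {n : ℕ} (d : Fin 4 → ℕ)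
    (F : Fin 4 → MvPolynomial (Fin n) K) (hF : ∀ i, IsHomogZ K n (d i : ℤ) (F i)) (k : Fin 4) :
    F k = gpol (fun i : Idx (n := n) d => coeff i.1.2 (F i.1.1)) k := by
  ext e
  rw [coeff_gpol]
  split_ifs with h
  · rfl
  · by_contra h0
    have := hF k e (mem_support_iff.mpr h0)
    apply h
    rw [Finsupp.degree_eq_sum]
    exact_mod_cast this

theorem gpol_homog {K : Type} [Field K] {n : ℕ} (d : Fin 4 → ℕ)
    (b : Idx (n := n) d → K) (k : Fin 4) : IsHomogZ K n (d k : ℤ) (gpol b k) := by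
  intro e he
  rw [mem_support_iff, coeff_gpol] at he
  split_ifs at he with h
  · rw [← h, Finsupp.degree_eq_sum]
    push_cast
    rfl
  · exact absurd rfl he

theorem sing_eqs {K : Type} [Field K] [CharP K 2] {n : ℕ} (F : Fin 4 → MvPolynomial (Fin n) K)
    (p : Pt K n 3) (hp : ¬ (p.2 0 = 0 ∧ p.2 1 = 0)) (hg : evalPt K p (specialMemberZ K F) = 0)
    (hs : ∀ v, evalPt K p (pderiv v (specialMemberZ K F)) = 0) :
    eval p.1 (F 2) = 0 ∧ eval p.1 (F 3) = 0 ∧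
    eval p.1 (F 0) * p.2 0 ^ 2 + eval p.1 (F 1) * p.2 1 ^ 2 = 0 ∧
    ∀ j, eval p.1 (pderiv j (F 0)) * p.2 0 ^ 2 + eval p.1 (pderiv j (F 1)) * p.2 1 ^ 2
      + eval p.1 (pderiv j (F 2)) * p.2 2 + eval p.1 (pderiv j (F 3)) * p.2 0 * p.2 1 = 0 := by
  have h2 : (2 : K) = 0 := by exact_mod_cast CharP.cast_eq_zero K 2
  have er : ∀ G : MvPolynomial (Fin n) K,
      eval (Sum.elim p.1 p.2) (rename Sum.inl G) = eval p.1 G := by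
    intro G; rw [eval_rename]; rfl
  have dl : ∀ (G : MvPolynomial (Fin n) K) (j : Fin n),
      pderiv (Sum.inl j : Fin n ⊕ Fin 3) (rename Sum.inl G) = rename Sum.inl (pderiv j G) := by
    intro G j; exact pderiv_rename Sum.inl_injective _ _
  have dr : ∀ (G : MvPolynomial (Fin n) K) (j : Fin 3),
      pderiv (Sum.inr j : Fin n ⊕ Fin 3) (rename Sum.inl G) = 0 := by
    intro G j
    classical
    apply pderiv_eq_zero_of_notMem_vars
    intro h
    have := vars_rename (Sum.inl : Fin n → Fin n ⊕ Fin 3) G h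
    simp at this
  have c2 := hs (Sum.inr 2)
  have c0 := hs (Sum.inr 0)
  have c1 := hs (Sum.inr 1)
  simp [evalPt, specialMemberZ, pderiv_mul, pderiv_pow, dr, er, pderiv_X, Pi.single_apply, h2]
    at c0 c1 c2
  have hf : eval p.1 (F 3) = 0 := by
    by_contra hf
    apply hp
    tauto
  refine ⟨c2, hf, ?_, ?_⟩
  · simp [evalPt, specialMemberZ, er, c2, hf] at hg
    exact hg
  · intro j
    have := hs (Sum.inl j)
    simp [evalPt, specialMemberZ, pderiv_mul, pderiv_pow, dl, er, pderiv_X] at this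
    linear_combination this

theorem main_nat (K : Type) [Field K] [IsAlgClosed K] [CharP K 2] (n : ℕ) (d : Fin 4 → ℕ)
    (hd0 : 1 ≤ d 0) (hd1 : 1 ≤ d 1) (hdd : d 0 + d 1 = 2 * d 3) :
    GenerallyHolds4 K n (fun k => (d k : ℤ))
      (fun abcf =>
        JacobiSmoothOn K (specialMemberZ K abcf)
          {p | p.1 ≠ 0 ∧ ¬ (p.2 0 = 0 ∧ p.2 1 = 0)}) := by
  have : Infinite K := IsAlgClosed.instInfinite
  choose D1 hD1 hD1' using fun i0 : Fin n => chart_scaled (K := K) d i0 0 1 hd0 (by decide)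
    (by decide) (by decide) (by decide) (by decide) hdd
  choose D2 hD2 hD2' using fun i0 : Fin n => chart_scaled (K := K) d i0 1 0 hd1 (by decide)
    (by decide) (by decide) (by decide) (by decide) (by omega)
  have hD : (∏ i, D1 i * D2 i) ≠ 0 :=
    Finset.prod_ne_zero_iff.mpr fun i _ => mul_ne_zero (hD1 i) (hD2 i)
  have hex : ∃ b, eval b (∏ i, D1 i * D2 i) ≠ 0 := by
    by_contra! h
    exact hD (MvPolynomial.funext fun x => by rw [h x, map_zero])
  obtain ⟨b, hb⟩ := hex
  refine ⟨rename Subtype.val (∏ i, D1 i * D2 i), ⟨fun k => gpol b k, gpol_homog d b, ?_⟩, ?_⟩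
  · unfold evalCoeff4
    rw [eval_rename]
    convert hb using 3
    funext i
    simp only [Function.comp]
    rw [coeff_gpol, dif_pos i.2]
  · intro F hF hne p hp hg
    by_contra! hs
    obtain ⟨hc, hf, ha, hder⟩ := sing_eqs F p hp.2 hg hs
    obtain ⟨i0, hi0⟩ := Function.ne_iff.mp hp.1
    unfold evalCoeff4 at hne
    rw [eval_rename, map_prod, Finset.prod_ne_zero_iff] at hne
    have hne := hne i0 (Finset.mem_univ _)
    rw [map_mul] at hne
    have hFg := homog_eq_gpol d F hF
    by_cases hx : p.2 0 = 0
    · have hy : p.2 1 ≠ 0 := fun h => hp.2 ⟨hx, h⟩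
      refine right_ne_zero_of_mul hne (hD2' i0 _ p.1 (p.2 1) (p.2 0) (p.2 2) hi0 hy ?_ ?_ ?_ ?_)
      · exact (hFg 2) ▸ hc
      · exact (hFg 3) ▸ hf
      · erw [← hFg 0, ← hFg 1]
        linear_combination ha
      · intro j
        erw [← hFg 0, ← hFg 1, ← hFg 2, ← hFg 3]
        linear_combination hder j
    · refine left_ne_zero_of_mul hne (hD1' i0 _ p.1 (p.2 0) (p.2 1) (p.2 2) hi0 hx ?_ ?_ ?_ ?_)
      · exact (hFg 2) ▸ hc
      · exact (hFg 3) ▸ hf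
      · erw [← hFg 0, ← hFg 1]
        linear_combination ha
      · intro j
        erw [← hFg 0, ← hFg 1, ← hFg 2, ← hFg 3]
        linear_combination hder j

/-- **Lemma 3.6.**  Over an algebraically closed field of characteristic 2, the
open part `Z° = Z ∖ (x = y = 0)` of `Z = {a x² + b y² + c z̄ + f x y = 0} ⊂ R`
(the `ℙ(1,1,2)`-bundle over `ℙ^{n-1}`) is smooth, for `a,b,c,f` general of degrees
`-λ+μ+ν, λ-μ+ν, λ+μ-ν, ν`. -/
theorem lem_Z_circ_smooth_char_two
    (K : Type) [Field K] [IsAlgClosed K] [CharP K 2]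
    (n : ℕ) (hn : 3 ≤ n) (lam mu nu : ℤ)
    (h0 : 0 < lam) (h1 : lam ≤ mu) (h2 : mu ≤ nu) (h3 : nu ≤ lam + mu)
    (h4 : 3 ≤ nu) :
    GenerallyHolds4 K n ![-lam + mu + nu, lam - mu + nu, lam + mu - nu, nu]
      (fun abcf =>
        JacobiSmoothOn K (specialMemberZ K abcf)
          {p | p.1 ≠ 0 ∧ ¬ (p.2 0 = 0 ∧ p.2 1 = 0)}) := by
  have hmain := main_nat K n ![(-lam + mu + nu).toNat, (lam - mu + nu).toNat,
    (lam + mu - nu).toNat, nu.toNat] (by simp; omega) (by simp; omega) (by simp; omega)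
  convert hmain using 1
  funext k
  fin_cases k <;> simp <;> omega

end ConicBundleFormalization
end
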